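/- Let A ∈ L³_loc(ℝ³, ℝ³), let H_A be the self-adjoint closure of the magnetic Dirac operator [[1, −iσ·∇_A], [−iσ·∇_A, −1]] (where ∇_A = ∇ − iA), which is essentially self-adjoint on C_0^∞(ℝ³ \ {0})⁴, and assume that B := curl A is essentially bounded. Then: (i) ‖ |x|^{-1} u ‖² ≤ 4 ‖H_A u‖² + 4 ‖B‖_∞ ‖u‖² for all u ∈ dom(H_A); (ii) |( |x|^{-1} u, u )| ≤ (π/2) ‖ |H_A|^{1/2} u ‖² + (π/2) √(‖B‖_∞) ‖u‖² for all u ∈ dom(|H_A|^{1/2}). -/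

import Mathlib

noncomputable section

open Complex Filter Topology MeasureTheory

namespace Paper

variable {X : Type*} [NormedAddCommGroup X] [NormedSpace ℂ X]

/-- `R` is a (two-sided) bounded resolvent of the unbounded operator `T` at the point `z`. -/
def IsResolventAt (T : X →ₗ.[ℂ] X) (z : ℂ) (R : X →L[ℂ] X) : Prop :=
  (∀ u : T.domain, R (T u - z • (u : X)) = u) ∧
  (∀ y : X, ∃ hy : R y ∈ T.domain, T ⟨R y, hy⟩ - z • R y = y)

/-- The resolvent set of an unbounded operator. -/
def resolventSet (T : X →ₗ.[ℂ] X) : Set ℂ := {z | ∃ R, IsResolventAt T z R}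

/-- The spectrum of an unbounded operator. -/
def spec (T : X →ₗ.[ℂ] X) : Set ℂ := (resolventSet T)ᶜ

open Classical in
/-- The resolvent operator of `T` at `z` (junk value `0` if `z` is not in the resolvent set). -/
def res (T : X →ₗ.[ℂ] X) (z : ℂ) : X →L[ℂ] X :=
  if h : z ∈ resolventSet T then Classical.choose h else 0

open Classical in
/-- Application of an unbounded operator, with junk value `0` outside of the domain. -/
def pApply (T : X →ₗ.[ℂ] X) (u : X) : X :=
  if h : u ∈ T.domain then T ⟨u, h⟩ else 0

/-- `R` is a bounded resolvent at `z` of the part of `T` in the range of the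
(not necessarily orthogonal) projection `Q`. -/
def IsPartResolventAt (T : X →ₗ.[ℂ] X) (Q : X →L[ℂ] X) (z : ℂ) (R : X →L[ℂ] X) : Prop :=
  (∀ y, R (Q y) = R y) ∧ (∀ y, Q (R y) = R y) ∧
  (∀ y, ∃ hy : R y ∈ T.domain, T ⟨R y, hy⟩ - z • R y = Q y) ∧
  (∀ u : T.domain, Q (u : X) = (u : X) → R (T u - z • (u : X)) = (u : X))

/-- The spectrum of the part `T|_{ran Q}` of `T` in the range of the projection `Q`. -/
def partSpec (T : X →ₗ.[ℂ] X) (Q : X →L[ℂ] X) : Set ℂ :=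
  {z | ¬∃ R, IsPartResolventAt T Q z R}

/-- `T` is decomposed according to `X = Q₊X ∔ Q₋X`: the `Q₊, Q₋` are complementary (bounded)
projections whose ranges are invariant under `T`. -/
def DecomposedBy (T : X →ₗ.[ℂ] X) (Qp Qm : X →L[ℂ] X) : Prop :=
  Qp + Qm = 1 ∧ IsIdempotentElem Qp ∧ IsIdempotentElem Qm ∧
  (∀ u : T.domain, ∃ hp : Qp (u : X) ∈ T.domain, T ⟨Qp (u : X), hp⟩ = Qp (T u)) ∧
  (∀ u : T.domain, ∃ hm : Qm (u : X) ∈ T.domain, T ⟨Qm (u : X), hm⟩ = Qm (T u))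

/-- `D` is a core for the closed operator `T`: the closure of the restriction of `T` to `D`
is again `T`. -/
def IsCore (T : X →ₗ.[ℂ] X) (D : Submodule ℂ X) : Prop :=
  D ≤ T.domain ∧ (T.domRestrict D).closure = T

/-- The operator `W⁻¹ T W` (with `W' = W⁻¹`). -/
def conjPMap (W W' : X →L[ℂ] X) (T : X →ₗ.[ℂ] X) : X →ₗ.[ℂ] X where
  domain := T.domain.comap (W : X →ₗ[ℂ] X)
  toFun := (W' : X →ₗ[ℂ] X) ∘ₗ (T.toFun ∘ₗ ((W : X →ₗ[ℂ] X).restrict fun _ hx => hx))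

/-- The linear span of the graph of `f` restricted to `D`; if `f` is linear on `D` this is
the graph of the corresponding operator with domain `D`. -/
def graphSpan (D : Submodule ℂ X) (f : X → X) : Submodule ℂ (X × X) :=
  Submodule.span ℂ {p : X × X | p.1 ∈ D ∧ p.2 = f p.1}

/-- The unbounded operator with domain `D` acting as `f` (obtained from the span of the
graph of `f|_D`). -/
def pmapOf (D : Submodule ℂ X) (f : X → X) : X →ₗ.[ℂ] X := (graphSpan D f).toLinearPMap
section Hilbert

variable {H : Type*} [NormedAddCommGroup H] [InnerProductSpace ℂ H] [CompleteSpace H]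

local notation "⟪" x ", " y "⟫" => @inner ℂ _ _ x y

/-- The inverse of a bounded operator `J`, as an unbounded operator (defined via the
flipped graph of `J`; if `J` is injective this is the genuine inverse with domain `ran J`). -/
def pinv (J : H →L[ℂ] H) : H →ₗ.[ℂ] H :=
  ((LinearMap.graph (J : H →ₗ[ℂ] H)).map
    ((LinearEquiv.prodComm ℂ H H) : H × H →ₗ[ℂ] H × H)).toLinearPMap

/-- For `R` self-adjoint, `|R| = √(R²)`. -/
def absCLM (R : H →L[ℂ] H) : H →L[ℂ] H := CFC.sqrt (R * R)

/-- For `R = H₀⁻¹` with `H₀` self-adjoint, this is `|H₀|^{-1/2} = √(|R|)`. -/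
def invSqrtAbs (R : H →L[ℂ] H) : H →L[ℂ] H := CFC.sqrt (absCLM R)

/-- For `R = H₀⁻¹` with `H₀` self-adjoint, this is the unbounded operator `|H₀|^{1/2}`,
realized as the inverse of `|H₀|^{-1/2}`; its domain is `dom |H₀|^{1/2}`. -/
def sqrtAbsPMap (R : H →L[ℂ] H) : H →ₗ.[ℂ] H := pinv (invSqrtAbs R)

/-- `U` is the sign `sign(H₀) = sign(H₀⁻¹) = sign(R)` of the boundedly invertible self-adjoint
operator `H₀ = R⁻¹`: a self-adjoint involution with `R U = U R = |R|`. -/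
def IsSignOf (U R : H →L[ℂ] H) : Prop :=
  IsSelfAdjoint U ∧ U * U = 1 ∧ R * U = absCLM R ∧ U * R = absCLM R

/-- The quadratic form `h₀` represented by `H₀ = R⁻¹`:
`h₀[u,w] = (|H₀|^{1/2}u, sign(H₀)|H₀|^{1/2}w)`, linear in `u` and conjugate-linear in `w`
(values outside `dom |H₀|^{1/2}` are junk). -/
def h0form (R U : H →L[ℂ] H) (u w : H) : ℂ :=
  ⟪U (pApply (sqrtAbsPMap R) w), pApply (sqrtAbsPMap R) u⟫

/-- `v` is a sesquilinear form on `Q` (linear in the first, conjugate-linear in the second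
argument, as in the paper). -/
def SesqOn (Q : Submodule ℂ H) (v : H → H → ℂ) : Prop :=
  (∀ u₁ u₂ w, u₁ ∈ Q → u₂ ∈ Q → w ∈ Q → v (u₁ + u₂) w = v u₁ w + v u₂ w) ∧
  (∀ (c : ℂ) u w, u ∈ Q → w ∈ Q → v (c • u) w = c * v u w) ∧
  (∀ u w₁ w₂, u ∈ Q → w₁ ∈ Q → w₂ ∈ Q → v u (w₁ + w₂) = v u w₁ + v u w₂) ∧
  (∀ (c : ℂ) u w, u ∈ Q → w ∈ Q → v u (c • w) = (starRingEnd ℂ) c * v u w)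

/-- `T` is the operator associated with the densely defined sesquilinear form `h`
with form domain `Q` (in the sense of the paper):
`T` is closed and densely defined, `dom T, dom T* ⊆ Q`, `(Tu, w) = h[u, w]` for
`u ∈ dom T`, `w ∈ Q`, and `(u, T*w) = h[u, w]` for `u ∈ Q`, `w ∈ dom T*`.
(The paper's inner product `(·,·)` is linear in the first argument, so
`(x, y) = ⟪y, x⟫` in Mathlib conventions.) -/
def IsAssocForm (Q : Submodule ℂ H) (h : H → H → ℂ) (T : H →ₗ.[ℂ] H) : Prop :=
  T.IsClosed ∧ Dense (T.domain : Set H) ∧ T.domain ≤ Q ∧ T.adjoint.domain ≤ Q ∧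
  (∀ u : T.domain, ∀ w ∈ Q, ⟪w, T u⟫ = h u w) ∧
  (∀ u ∈ Q, ∀ w : T.adjoint.domain, ⟪T.adjoint w, u⟫ = h u w)

/-- `‖H_{a,b}^{1/2} u‖ = (a‖u‖² + b‖|H₀|^{1/2}u‖²)^{1/2}` for `u ∈ dom |H₀|^{1/2}`,
where `H_{a,b} = a + b|H₀|` and `R = H₀⁻¹`. -/
def habNorm (R : H →L[ℂ] H) (a b : ℝ) (u : H) : ℝ :=
  Real.sqrt (a * ‖u‖ ^ 2 + b * ‖pApply (sqrtAbsPMap R) u‖ ^ 2)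

/-- `Pp, Pm` are the spectral projections of the bounded self-adjoint operator `R` onto its
positive and negative spectral subspaces (`R` is assumed injective, e.g. the inverse of a
self-adjoint operator, so that the pair is uniquely determined). -/
def IsPosNegPair (R Pp Pm : H →L[ℂ] H) : Prop :=
  Pp + Pm = 1 ∧ IsSelfAdjoint Pp ∧ IsSelfAdjoint Pm ∧
  IsIdempotentElem Pp ∧ IsIdempotentElem Pm ∧
  Pp * R = R * Pp ∧
  (∀ x : H, 0 ≤ (⟪Pp x, R (Pp x)⟫).re) ∧ (∀ x : H, (⟪Pm x, R (Pm x)⟫).re ≤ 0)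

/-- Membership in the Schatten-von Neumann class of order `p`, via the Schmidt
representation `A = ∑ sₙ ⟪eₙ, ·⟫ fₙ` with `(sₙ) ∈ ℓᵖ`. -/
def MemSchatten (p : ℝ) (A : H →L[ℂ] H) : Prop :=
  ∃ (s : ℕ → ℝ) (e f : ℕ → H), Orthonormal ℂ e ∧ Orthonormal ℂ f ∧ (∀ n, 0 ≤ s n) ∧
    Summable (fun n => s n ^ p) ∧
    ∀ x : H, HasSum (fun n => s n • (⟪e n, x⟫ • f n)) (A x)

end Hilbert


section Dirac

open ComplexConjugate

/-- Euclidean 3-space. -/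
abbrev V3 := EuclideanSpace ℝ (Fin 3)

/-- The spinor space `ℂ⁴`. -/
abbrev C4 := EuclideanSpace ℂ (Fin 4)

/-- Two-component spinors `ℂ²`. -/
abbrev C2 := EuclideanSpace ℂ (Fin 2)

/-- The Hilbert space `L²(ℝ³, ℂ⁴)`. -/
abbrev DSp := MeasureTheory.Lp (α := V3) C4 2 (volume : Measure V3)

/-- The Hilbert space `L²(ℝ³, ℂ²)` (for the Pauli operator). -/
abbrev DSp2 := MeasureTheory.Lp (α := V3) C2 2 (volume : Measure V3)

/-- Application of a `4 × 4` matrix to a spinor. -/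
def mapp (M : Matrix (Fin 4) (Fin 4) ℂ) (ξ : C4) : C4 :=
  (WithLp.equiv 2 (Fin 4 → ℂ)).symm (M.mulVec (WithLp.equiv 2 (Fin 4 → ℂ) ξ))

/-- Application of a `2 × 2` matrix to a two-component spinor. -/
def mapp2 (M : Matrix (Fin 2) (Fin 2) ℂ) (ξ : C2) : C2 :=
  (WithLp.equiv 2 (Fin 2 → ℂ)).symm (M.mulVec (WithLp.equiv 2 (Fin 2 → ℂ) ξ))

/-- The Pauli matrices `σ₁, σ₂, σ₃`. -/
def pauli : Fin 3 → Matrix (Fin 2) (Fin 2) ℂ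
  | 0 => !![0, 1; 1, 0]
  | 1 => !![0, -Complex.I; Complex.I, 0]
  | 2 => !![1, 0; 0, -1]

/-- The Dirac matrices `α_j = [[0, σ_j], [σ_j, 0]]`. -/
def diracα : Fin 3 → Matrix (Fin 4) (Fin 4) ℂ
  | 0 => !![0, 0, 0, 1;
            0, 0, 1, 0;
            0, 1, 0, 0;
            1, 0, 0, 0]
  | 1 => !![0, 0, 0, -Complex.I;
            0, 0, Complex.I, 0;
            0, -Complex.I, 0, 0;
            Complex.I, 0, 0, 0]
  | 2 => !![0, 0, 1, 0;
            0, 0, 0, -1;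
            1, 0, 0, 0;
            0, -1, 0, 0]

/-- The Dirac matrix `β = diag(1, 1, -1, -1)`. -/
def diracβ : Matrix (Fin 4) (Fin 4) ℂ :=
  !![1, 0, 0, 0;
     0, 1, 0, 0;
     0, 0, -1, 0;
     0, 0, 0, -1]

/-- The projection onto the upper two spinor components. -/
def upperMat : Matrix (Fin 4) (Fin 4) ℂ :=
  !![1, 0, 0, 0;
     0, 1, 0, 0;
     0, 0, 0, 0;
     0, 0, 0, 0]

/-- The projection onto the lower two spinor components. -/
def lowerMat : Matrix (Fin 4) (Fin 4) ℂ :=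
  !![0, 0, 0, 0;
     0, 0, 0, 0;
     0, 0, 1, 0;
     0, 0, 0, 1]

/-- The classical action of the free Dirac operator
`H₀ = β - i Σ_j α_j ∂_j` on a differentiable function. -/
def diracAct (f : V3 → C4) (x : V3) : C4 :=
  mapp diracβ (f x) -
    Complex.I • ∑ j : Fin 3, mapp (diracα j) (fderiv ℝ f x (EuclideanSpace.single j (1 : ℝ)))

/-- The classical action of the magnetic Dirac operator
`H_A = β - i Σ_j α_j ∂_j - Σ_j A_j α_j` (i.e. with `-iσ·∇` replaced by
`-iσ·∇_A = -iσ·∇ - σ·A`). -/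
def diracActA (A : V3 → V3) (f : V3 → C4) (x : V3) : C4 :=
  mapp diracβ (f x) -
    Complex.I • ∑ j : Fin 3, mapp (diracα j) (fderiv ℝ f x (EuclideanSpace.single j (1 : ℝ))) -
    ∑ j : Fin 3, (A x j : ℂ) • mapp (diracα j) (f x)

/-- The classical action of the operator `-iσ·∇_A = -iσ·∇ - σ·A` on two-component spinors. -/
def pauliDiracAct (A : V3 → V3) (f : V3 → C2) (x : V3) : C2 :=
  (-Complex.I) • ∑ j : Fin 3, mapp2 (pauli j) (fderiv ℝ f x (EuclideanSpace.single j (1 : ℝ))) -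
    ∑ j : Fin 3, (A x j : ℂ) • mapp2 (pauli j) (f x)

/-- A smooth compactly supported (test) function. -/
def IsTestFn (f : V3 → C4) : Prop := ContDiff ℝ (⊤ : ℕ∞) f ∧ HasCompactSupport f

/-- A smooth compactly supported function supported away from the origin. -/
def IsTestFnAway (f : V3 → C4) : Prop :=
  ContDiff ℝ (⊤ : ℕ∞) f ∧ HasCompactSupport f ∧ (0 : V3) ∉ tsupport f

/-- The subspace of `L²(ℝ³, ℂ⁴)` of (classes of) test functions. -/
def testSub : Submodule ℂ DSp :=
  Submodule.span ℂ {u : DSp | ∃ f : V3 → C4, IsTestFn f ∧ ⇑u =ᵐ[volume] f}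

/-- The subspace of (classes of) test functions supported away from the origin,
`C₀^∞(ℝ³ \ {0})⁴`. -/
def testSubAway : Submodule ℂ DSp :=
  Submodule.span ℂ {u : DSp | ∃ f : V3 → C4, IsTestFnAway f ∧ ⇑u =ᵐ[volume] f}

/-- `H₀` is the free Dirac operator on `ℝ³` (units `m = c = ħ = 1`): it is self-adjoint,
acts as `diracAct` on test functions, and the test functions form a core (which, together
with self-adjointness, determines it uniquely; its domain is `H¹(ℝ³, ℂ⁴)`). -/
def IsFreeDirac (H0 : DSp →ₗ.[ℂ] DSp) : Prop :=
  H0.adjoint = H0 ∧ IsCore H0 testSub ∧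
  ∀ (u : DSp) (f : V3 → C4), IsTestFn f → ⇑u =ᵐ[volume] f →
    ∃ hu : u ∈ H0.domain, ⇑(H0 ⟨u, hu⟩) =ᵐ[volume] fun x => diracAct f x

/-- `HA` is the magnetic Dirac operator with vector potential `A`: the self-adjoint
closure of the classical magnetic Dirac operator on `C₀^∞(ℝ³ \ {0})⁴` (on which it is
essentially self-adjoint). -/
def IsMagneticDirac (A : V3 → V3) (HA : DSp →ₗ.[ℂ] DSp) : Prop :=
  HA.adjoint = HA ∧ IsCore HA testSubAway ∧
  ∀ (u : DSp) (f : V3 → C4), IsTestFnAway f → ⇑u =ᵐ[volume] f →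
    ∃ hu : u ∈ HA.domain, ⇑(HA ⟨u, hu⟩) =ᵐ[volume] fun x => diracActA A f x

/-- `Bfun` is the distributional curl of the vector potential `A`:
`(curl A)_i = ∂_{i+1} A_{i+2} - ∂_{i+2} A_{i+1}` (cyclically), tested against smooth
compactly supported functions. -/
def IsCurlOf (A : V3 → V3) (Bfun : V3 → V3) : Prop :=
  ∀ (i : Fin 3) (φ : V3 → ℝ), ContDiff ℝ (⊤ : ℕ∞) φ → HasCompactSupport φ →
    ∫ x : V3, Bfun x i * φ x =
      ∫ x : V3, (A x (i + 1) * fderiv ℝ φ x (EuclideanSpace.single (i + 2) (1 : ℝ)) -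
        A x (i + 2) * fderiv ℝ φ x (EuclideanSpace.single (i + 1) (1 : ℝ)))

end Dirac

section RiccatiComparison

variable {H : Type*} [NormedAddCommGroup H] [InnerProductSpace ℂ H] [CompleteSpace H]

/-- A positive operator that dominates the source term of a Riccati equation dominates
every solution which decays at infinity. -/
theorem riccati_comparison {δ : ℝ} (hδ : 0 < δ) {V G : ℝ → H →L[ℂ] H} {K : H →L[ℂ] H}
    (hV : ∀ t, δ ≤ t → HasDerivAt V (V t * V t - G t) t)
    (hVsa : ∀ t, δ ≤ t → IsSelfAdjoint (V t)) (hVn : ∀ t, δ ≤ t → ‖V t‖ ≤ 1 / t)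
    (hKsa : IsSelfAdjoint K) (hK : ∀ v, 0 ≤ (inner ℂ v (K v)).re)
    (hG : ∀ t, δ ≤ t → ∀ v, (inner ℂ v (G t v)).re ≤ ‖K v‖ ^ 2) (u : H) :
    (inner ℂ u (V δ u)).re ≤ (inner ℂ u (K u)).re := by
  let _ : InnerProductSpace ℝ H := InnerProductSpace.complexToReal
  set U : ℝ → H := fun t => NormedSpace.exp ((t - δ) • (-K)) u with hU
  have hUd : ∀ t, HasDerivAt U (-(K (U t))) t := by
    intro t
    have h1 := (hasDerivAt_exp_smul_const' (𝕂 := ℝ) (-K) (t - δ)).comp_sub_const t δ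
    have h2 :=
      ((ContinuousLinearMap.apply ℂ H u).restrictScalars ℝ).hasFDerivAt.comp_hasDerivAt t h1
    simpa [hU, Function.comp_def] using h2
  have hUδ : U δ = u := by simp [hU]
  have symK : ∀ x y : H, (inner ℂ x (K y)).re = (inner ℂ (K x) y).re := by
    intro x y
    rw [← ContinuousLinearMap.adjoint_inner_left, ← ContinuousLinearMap.star_eq_adjoint, hKsa]
  have symV : ∀ t, δ ≤ t → ∀ x y : H, (inner ℂ x (V t y)).re = (inner ℂ (V t x) y).re := by
    intro t ht x y
    rw [← ContinuousLinearMap.adjoint_inner_left, ← ContinuousLinearMap.star_eq_adjoint,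
      hVsa t ht]
  have comm : ∀ x y : H, (inner ℂ x y).re = (inner ℂ y x).re := fun x y =>
    inner_re_symm (𝕜 := ℂ) x y
  have hpair : ∀ {f g : ℝ → H} {f' g' : H} {t : ℝ}, HasDerivAt f f' t → HasDerivAt g g' t →
      HasDerivAt (fun s => (inner ℂ (f s) (g s)).re)
        ((inner ℂ (f t) g').re + (inner ℂ f' (g t)).re) t := by
    intro f g f' g' t hf hg
    exact hf.inner ℝ hg
  have hKU : ∀ t, HasDerivAt (fun s => K (U s)) (K (-(K (U t)))) t := fun t =>
    (K.restrictScalars ℝ).hasFDerivAt.comp_hasDerivAt t (hUd t)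
  have hVU : ∀ t, δ ≤ t → HasDerivAt (fun s => V s (U s))
      ((V t * V t - G t) (U t) + V t (-(K (U t)))) t := by
    intro t ht
    have hV' : HasDerivAt (fun s => (V s).restrictScalars ℝ)
        ((V t * V t - G t).restrictScalars ℝ) t :=
      (ContinuousLinearMap.restrictScalarsL ℂ H H ℝ ℝ).hasFDerivAt.comp_hasDerivAt t (hV t ht)
    exact hV'.clm_apply (hUd t)
  have hnorm : ∀ t, δ ≤ t → ‖U t‖ ^ 2 ≤ ‖u‖ ^ 2 := by
    have hd : ∀ t, HasDerivAt (fun s => (inner ℂ (U s) (U s)).re)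
        ((inner ℂ (U t) (-(K (U t)))).re + (inner ℂ (-(K (U t))) (U t)).re) t :=
      fun t => hpair (hUd t) (hUd t)
    have ha : AntitoneOn (fun s => (inner ℂ (U s) (U s)).re) (Set.Ici δ) := by
      refine antitoneOn_of_deriv_nonpos (convex_Ici δ)
        (fun t _ => (hd t).continuousAt.continuousWithinAt)
        (fun t _ => (hd t).differentiableAt.differentiableWithinAt) fun t _ => ?_
      rw [(hd t).deriv, comm (-(K (U t)))]
      have := hK (U t)
      simp only [inner_neg_right, Complex.neg_re]
      linarith
    intro t ht
    have := ha Set.self_mem_Ici ht ht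
    simp only [hUδ] at this
    have e : ∀ x : H, (inner ℂ x x).re = ‖x‖ ^ 2 := fun x => by
      rw [inner_self_eq_norm_sq_to_K]; norm_cast
    rwa [e, e] at this
  set q : ℝ → ℝ := fun t => (inner ℂ (U t) (K (U t))).re - (inner ℂ (U t) (V t (U t))).re with hq
  have hqd : ∀ t, δ ≤ t → HasDerivAt q _ t := fun t ht =>
    (hpair (hUd t) (hKU t)).sub (hpair (hUd t) (hVU t ht))
  have hqa : AntitoneOn q (Set.Ici δ) := by
    refine antitoneOn_of_deriv_nonpos (convex_Ici δ)
      (fun t ht => (hqd t ht).continuousAt.continuousWithinAt)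
      (fun t ht => (hqd t (interior_subset ht)).differentiableAt.differentiableWithinAt)
      fun t ht => ?_
    have ht : δ ≤ t := interior_subset ht
    rw [(hqd t ht).deriv]
    have h1 := hG t ht (U t)
    have h2 : 0 ≤ ‖K (U t) - V t (U t)‖ ^ 2 := sq_nonneg _
    have e : ∀ x : H, ‖x‖ ^ 2 = (inner ℂ x x).re := fun x => by
      rw [inner_self_eq_norm_sq_to_K]; norm_cast
    rw [e] at h1 h2
    have hVV : (V t * V t) (U t) = V t (V t (U t)) := rfl
    simp only [inner_sub_left, inner_sub_right, map_neg, inner_neg_right, inner_neg_left,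
      sub_apply, hVV, inner_add_right,
      Complex.sub_re, Complex.add_re, Complex.neg_re, symK (U t), symV t ht (U t),
      comm (V t (U t)) (K (U t))] at h1 h2 ⊢
    linarith
  have hlim : ∀ t, δ ≤ t → -(‖u‖ ^ 2 * (1 / t)) ≤ q δ := by
    intro t ht
    have h0 : 0 < t := hδ.trans_le ht
    refine le_trans ?_ (hqa Set.self_mem_Ici ht ht)
    have h1 : (inner ℂ (U t) (V t (U t))).re ≤ ‖u‖ ^ 2 * (1 / t) := by
      calc (inner ℂ (U t) (V t (U t))).re ≤ ‖U t‖ * ‖V t (U t)‖ := re_inner_le_norm (𝕜 := ℂ) _ _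
        _ ≤ ‖U t‖ * (1 / t * ‖U t‖) := by
          gcongr
          exact (V t).le_of_opNorm_le (hVn t ht) _
        _ = ‖U t‖ ^ 2 * (1 / t) := by ring
        _ ≤ _ := by gcongr ?_ * _; exact hnorm t ht
    have := hK (U t)
    simp only [hq]
    linarith
  have hq0 : 0 ≤ q δ := by
    have h1 : Tendsto (fun t : ℝ => -(‖u‖ ^ 2 * (1 / t))) atTop (𝓝 (-(‖u‖ ^ 2 * 0))) :=
      by
      simp only [one_div]
      exact (tendsto_const_nhds.mul tendsto_inv_atTop_zero).neg
    simp only [mul_zero, neg_zero] at h1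
    exact le_of_tendsto h1 ((eventually_ge_atTop δ).mono hlim)
  simp only [hq, hUδ] at hq0
  linarith

end RiccatiComparison

section SquareRootOfResolvent

variable {H : Type*} [NormedAddCommGroup H] [InnerProductSpace ℂ H] [CompleteSpace H]

theorem re_inner_cfc_mono {R : H →L[ℂ] H} {f g : ℝ → ℝ} (hf : Continuous f)
    (hg : Continuous g) (h : ∀ s, f s ≤ g s) (x : H) :
    (inner ℂ x (cfc f R x)).re ≤ (inner ℂ x (cfc g R x)).re := by
  have h1 : cfc f R ≤ cfc g R :=
    cfc_mono (fun s _ => h s) hf.continuousOn hg.continuousOn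
  have h2 := (ContinuousLinearMap.le_def _ _).1 h1
  have h3 := h2.re_inner_nonneg_right x
  simp only [sub_apply, inner_sub_right, map_sub] at h3
  exact sub_nonneg.1 h3

theorem re_inner_cfc_apply_left {R : H →L[ℂ] H} (f : ℝ → ℝ) (x y : H) :
    (inner ℂ (cfc f R x) y) = (inner ℂ x (cfc f R y)) := by
  have h : IsSelfAdjoint (cfc f R) := cfc_predicate f R
  rw [← ContinuousLinearMap.adjoint_inner_right, ← ContinuousLinearMap.star_eq_adjoint, h]

theorem norm_sq_cfc_apply {R : H →L[ℂ] H} {f : ℝ → ℝ} (hf : Continuous f) (x : H) :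
    ‖cfc f R x‖ ^ 2 = (inner ℂ x (cfc (fun s => f s * f s) R x)).re := by
  rw [cfc_mul f f R hf.continuousOn hf.continuousOn]
  change _ = (inner ℂ x (cfc f R (cfc f R x))).re
  rw [← re_inner_cfc_apply_left, inner_self_eq_norm_sq_to_K]
  norm_cast

theorem absCLM_eq_cfc {R : H →L[ℂ] H} (hR : IsSelfAdjoint R) :
    absCLM R = cfc (fun s : ℝ => |s|) R := by
  refine CFC.sqrt_unique ?_ (cfc_nonneg fun s _ => abs_nonneg s)
  rw [← cfc_mul _ _ R continuous_abs.continuousOn continuous_abs.continuousOn]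
  simp only [abs_mul_abs_self]
  rw [cfc_mul (fun s : ℝ => s) (fun s : ℝ => s) R, cfc_id' ℝ R]

theorem invSqrtAbs_eq_cfc {R : H →L[ℂ] H} (hR : IsSelfAdjoint R) :
    invSqrtAbs R = cfc (fun s : ℝ => √|s|) R := by
  refine CFC.sqrt_unique ?_ (cfc_nonneg fun s _ => Real.sqrt_nonneg _)
  have hc : Continuous fun s : ℝ => √|s| := by fun_prop
  rw [← cfc_mul _ _ R hc.continuousOn hc.continuousOn, absCLM_eq_cfc hR]
  simp

theorem cfc_mul_apply {R : H →L[ℂ] H} {f g : ℝ → ℝ} (hf : Continuous f) (hg : Continuous g)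
    (x : H) : cfc f R (cfc g R x) = cfc (fun s => f s * g s) R x := by
  rw [cfc_mul f g R hf.continuousOn hg.continuousOn]
  rfl

theorem re_inner_convex {E : Type*} [NormedAddCommGroup E] [InnerProductSpace ℂ E]
    {G : E →L[ℂ] E} (hG : ∀ v, 0 ≤ (inner ℂ v (G v)).re) {η : ℝ}
    (h0 : 0 ≤ η) (h1 : η ≤ 1) (x y : E) :
    (inner ℂ ((1 - η) • x + η • y) (G ((1 - η) • x + η • y))).re ≤
      (1 - η) * (inner ℂ x (G x)).re + η * (inner ℂ y (G y)).re := by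
  have h := mul_nonneg (mul_nonneg h0 (sub_nonneg.2 h1)) (hG (x - y))
  have hs : ∀ (c : ℝ) (z : E), G (c • z) = c • G z := fun c z => G.map_smul_of_tower c z
  have hr : ∀ (c : ℝ) (z w : E), (inner ℂ z (c • w)).re = c * (inner ℂ z w).re := fun c z w => by
    rw [inner_smul_right_eq_smul]; simp
  have hl : ∀ (c : ℝ) (z w : E), (inner ℂ (c • z) w).re = c * (inner ℂ z w).re := fun c z w => by
    rw [inner_smul_left_eq_smul]; simp
  simp only [map_add, map_sub, hs, inner_add_left, inner_add_right, inner_sub_left,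
    inner_sub_right, Complex.add_re, Complex.sub_re, hr, hl] at h ⊢
  nlinarith

/-- A solution of a Riccati equation whose source term is dominated by `|R|⁻² + b²` in the
sense of quadratic forms is dominated by `|R|⁻¹ + b`. -/
theorem riccati_le_inv_abs {R : H →L[ℂ] H} (hR : IsSelfAdjoint R) {b : ℝ} (hb : 0 ≤ b)
    {V G : ℝ → H →L[ℂ] H}
    (hV : ∀ t, 0 < t → HasDerivAt V (V t * V t - G t) t)
    (hVsa : ∀ t, 0 < t → IsSelfAdjoint (V t)) (hVn : ∀ t, 0 < t → ‖V t‖ ≤ 1 / t)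
    (hG0 : ∀ t, 0 < t → ∀ v, 0 ≤ (inner ℂ v (G t v)).re)
    (hGn : ∀ t, 0 < t → ∀ v, (inner ℂ v (G t v)).re ≤ 2 / t ^ 2 * ‖v‖ ^ 2)
    (hGR : ∀ t, 0 < t → ∀ z, (inner ℂ (R z) (G t (R z))).re ≤ ‖z‖ ^ 2 + b ^ 2 * ‖R z‖ ^ 2)
    {δ : ℝ} (hδ : 0 < δ) (y : H) :
    (inner ℂ (invSqrtAbs R y) (V δ (invSqrtAbs R y))).re ≤
      ‖y‖ ^ 2 + b * ‖invSqrtAbs R y‖ ^ 2 := by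
  set S := invSqrtAbs R
  have key : ∀ η : ℝ, 0 < η → η < 1 → (1 - η) * (inner ℂ (S y) (V δ (S y))).re ≤
      ‖y‖ ^ 2 + b * ‖S y‖ ^ 2 := by
    intro η h0 h1
    have h1' : 0 < 1 - η := by linarith
    set c : ℝ := δ / 2 with hc
    have hc0 : 0 < c := by positivity
    set ε : ℝ := η * c with hε
    have hε0 : 0 < ε := by positivity
    have hbs : ∀ s : ℝ, 0 < 1 + b * |s| := fun s => by positivity
    have hes : ∀ s : ℝ, 0 < |s| + ε := fun s => by positivity
    set m : ℝ → ℝ := fun s => s / ((1 + b * |s|) * (|s| + ε)) with hm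
    have hmc : Continuous m := by
      refine Continuous.div (by fun_prop) (by fun_prop) fun s => ?_
      exact (mul_pos (hbs s) (hes s)).ne'
    set n : ℝ → ℝ := fun s => s * m s with hn
    have hnc : Continuous n := by fun_prop
    have hn0 : ∀ s, 0 ≤ n s := fun s => by
      have : n s = s ^ 2 / ((1 + b * |s|) * (|s| + ε)) := by simp only [hn, hm]; ring
      rw [this]
      have := hbs s; have := hes s
      positivity
    set j : ℝ → ℝ := fun s => (1 - η) * n s + ε with hj
    have hjc : Continuous j := by fun_prop
    have hj0 : ∀ s, 0 < j s := fun s => by have := hn0 s; positivity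
    set k : ℝ → ℝ := fun s => (j s)⁻¹ with hk
    have hkc : Continuous k := hjc.inv₀ fun s => (hj0 s).ne'
    have hk0 : ∀ s, 0 < k s := fun s => inv_pos.2 (hj0 s)
    set K : H →L[ℂ] H := cfc k R with hKdef
    have hKsa : IsSelfAdjoint K := cfc_predicate k R
    have hKpos : ∀ v, 0 ≤ (inner ℂ v (K v)).re := fun v => by
      have := re_inner_cfc_mono (R := R) (f := fun _ => 0) continuous_const hkc
        (fun s => (hk0 s).le) v
      simpa using this
    have hJ : ∀ x, cfc j R x = (1 - η) • R (cfc m R x) + η • (c • x) := by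
      intro x
      have e1 : cfc n R = R * cfc m R := by
        rw [cfc_mul (fun s => s) m R continuous_id.continuousOn hmc.continuousOn, cfc_id' ℝ R]
      have e2 : cfc j R = (1 - η) • cfc n R + ε • (1 : H →L[ℂ] H) := by
        rw [hj, cfc_add_const _ _ R (by fun_prop), cfc_const_mul _ _ R hnc.continuousOn,
          Algebra.algebraMap_eq_smul_one]
      rw [e2, e1, smul_smul, ← hε]
      rfl
    have hzx : ∀ x, ‖cfc m R x‖ ^ 2 + b ^ 2 * ‖R (cfc m R x)‖ ^ 2 ≤ ‖x‖ ^ 2 := by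
      intro x
      have e1 : R (cfc m R x) = cfc n R x := by
        rw [hn, ← cfc_mul_apply continuous_id' hmc, cfc_id' ℝ R]
      rw [e1, norm_sq_cfc_apply hmc, norm_sq_cfc_apply hnc]
      have e2 : (inner ℂ x (cfc (fun s => m s * m s) R x)).re +
          b ^ 2 * (inner ℂ x (cfc (fun s => n s * n s) R x)).re =
          (inner ℂ x (cfc (fun s => m s * m s + b ^ 2 * (n s * n s)) R x)).re := by
        rw [cfc_add R (fun s => m s * m s) (fun s => b ^ 2 * (n s * n s))
          (by fun_prop) (by fun_prop), cfc_const_mul (b ^ 2) (fun s => n s * n s) R (by fun_prop),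
          add_apply, inner_add_right, smul_apply,
          inner_smul_right_eq_smul, Complex.add_re, Complex.smul_re, smul_eq_mul]
      rw [e2]
      have h := re_inner_cfc_mono (R := R) (f := fun s => m s * m s + b ^ 2 * (n s * n s))
        (g := fun _ => 1) (by fun_prop) continuous_const (fun s => ?_) x
      · rw [cfc_const_one ℝ R] at h
        refine h.trans (le_of_eq ?_)
        change (inner ℂ x x).re = _
        rw [inner_self_eq_norm_sq_to_K]
        norm_cast
      · have e3 : m s * m s + b ^ 2 * (n s * n s) =
            (|s| ^ 2 / (|s| + ε) ^ 2) * ((1 + b ^ 2 * |s| ^ 2) / (1 + b * |s|) ^ 2) := by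
          simp only [hn, hm, sq_abs]
          have := (hbs s).ne'; have := (hes s).ne'
          field_simp
        rw [e3]
        have hs := abs_nonneg s
        refine mul_le_one₀ ?_ (by positivity) ?_
        · rw [div_le_one (by positivity)]
          gcongr
          linarith
        · rw [div_le_one (by positivity)]
          nlinarith [mul_nonneg hb hs]
    have hGK : ∀ t, δ ≤ t → ∀ v, (inner ℂ v (G t v)).re ≤ ‖K v‖ ^ 2 := by
      intro t ht v
      have ht0 : 0 < t := hδ.trans_le ht
      have e1 : cfc j R (K v) = v := by
        rw [hKdef, cfc_mul_apply hjc hkc]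
        have : (fun s => j s * k s) = fun _ => 1 := by
          funext s; exact mul_inv_cancel₀ (hj0 s).ne'
        rw [this, cfc_const_one ℝ R]
        rfl
      set x := K v
      rw [← e1, hJ]
      refine (re_inner_convex (hG0 t ht0) h0.le h1.le _ _).trans ?_
      have i1 := (hGR t ht0 (cfc m R x)).trans (hzx x)
      have i2 : (inner ℂ (c • x) (G t (c • x))).re ≤ ‖x‖ ^ 2 := by
        refine (hGn t ht0 _).trans ?_
        rw [norm_smul, Real.norm_of_nonneg hc0.le, mul_pow, ← mul_assoc]
        refine mul_le_of_le_one_left (sq_nonneg _) ?_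
        rw [hc, div_mul_eq_mul_div, div_le_one (by positivity)]
        nlinarith
      nlinarith
    have h := riccati_comparison hδ (fun t ht => hV t (hδ.trans_le ht))
      (fun t ht => hVsa t (hδ.trans_le ht)) (fun t ht => hVn t (hδ.trans_le ht))
      hKsa hKpos hGK (S y)
    have hr : Continuous fun s : ℝ => √|s| := by fun_prop
    have h2 : (1 - η) * (inner ℂ (S y) (K (S y))).re ≤ ‖y‖ ^ 2 + b * ‖S y‖ ^ 2 := by
      have hS : S = cfc (fun s : ℝ => √|s|) R := invSqrtAbs_eq_cfc hR
      have e1 : (1 - η) * (inner ℂ (S y) (K (S y))).re =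
          (inner ℂ y (cfc (fun s => (1 - η) * (√|s| * (k s * √|s|))) R y)).re := by
        rw [hS, re_inner_cfc_apply_left, hKdef, cfc_mul_apply hkc hr,
          cfc_mul_apply hr (by fun_prop), cfc_const_mul _ _ R (by fun_prop),
          smul_apply, inner_smul_right_eq_smul]
        simp
      have e2 : ‖y‖ ^ 2 + b * ‖S y‖ ^ 2 =
          (inner ℂ y (cfc (fun s => 1 + b * (√|s| * √|s|)) R y)).re := by
        rw [hS, norm_sq_cfc_apply hr, cfc_const_add _ _ R (by fun_prop),
          cfc_const_mul _ _ R (by fun_prop), add_apply, inner_add_right,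
          smul_apply, inner_smul_right_eq_smul, map_one]
        have : ((1 : H →L[ℂ] H) y) = y := rfl
        rw [this, inner_self_eq_norm_sq_to_K]
        simp
        norm_cast
      rw [e1, e2]
      refine re_inner_cfc_mono (by fun_prop) (by fun_prop) (fun s => ?_) y
      have hs := abs_nonneg s
      have e3 : √|s| * √|s| = |s| := Real.mul_self_sqrt hs
      have e4 : (1 - η) * (√|s| * (k s * √|s|)) = (1 - η) * |s| / j s := by
        rw [show (1 - η) * (√|s| * (k s * √|s|)) = (1 - η) * (√|s| * √|s|) * k s by ring, e3,
          div_eq_mul_inv]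
      rw [e3, e4, div_le_iff₀ (hj0 s)]
      have e5 : n s = |s| ^ 2 / ((1 + b * |s|) * (|s| + ε)) := by
        simp only [hn, hm, sq_abs]; ring
      have e6 : (1 + b * |s|) * j s = (1 - η) * (|s| ^ 2 / (|s| + ε)) + (1 + b * |s|) * ε := by
        simp only [hj, e5]
        have := (hbs s).ne'; have := (hes s).ne'
        field_simp
      rw [e6]
      have e7 : |s| ^ 2 / (|s| + ε) = |s| - ε + ε ^ 2 / (|s| + ε) := by
        have := (hes s).ne'
        field_simp
        ring
      rw [e7]
      have i1 : 0 ≤ ε ^ 2 / (|s| + ε) := by have := hes s; positivity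
      have i2 : 0 ≤ b * |s| * ε := by positivity
      nlinarith [mul_nonneg h1'.le i1, mul_pos h0 hε0]
    nlinarith
  have hlim : Tendsto (fun η : ℝ => (1 - η) * (inner ℂ (S y) (V δ (S y))).re) (𝓝[>] 0)
      (𝓝 ((1 - 0) * (inner ℂ (S y) (V δ (S y))).re)) :=
    ((continuous_const.sub continuous_id).mul continuous_const).continuousAt.tendsto.mono_left
      nhdsWithin_le_nhds
  rw [sub_zero, one_mul] at hlim
  refine le_of_tendsto hlim ?_
  filter_upwards [Ioo_mem_nhdsGT (zero_lt_one' ℝ)] with η hη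
  exact key η hη.1 hη.2

end SquareRootOfResolvent

section MultiplicationOperator

/-- Bounded measurable real functions. -/
def IsBddMeas (g : V3 → ℝ) : Prop := Measurable g ∧ ∃ C, ∀ x, |g x| ≤ C

theorem IsBddMeas.memLp {g : V3 → ℝ} (hg : IsBddMeas g) (u : DSp) :
    MemLp (fun x => (g x : ℂ) • u x) 2 volume := by
  obtain ⟨hm, C, hC⟩ := hg
  refine (Lp.memLp u).of_le_mul (c := C) ?_ (Eventually.of_forall fun x => ?_)
  · exact (Complex.measurable_ofReal.comp hm).aestronglyMeasurable.smul (Lp.aestronglyMeasurable u)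
  · rw [norm_smul, Complex.norm_real]
    exact mul_le_mul_of_nonneg_right (hC x) (norm_nonneg _)

open Classical in
/-- Multiplication by a bounded measurable function, as a bounded operator
(junk value `0` for other functions). -/
def mulOp (g : V3 → ℝ) : DSp →L[ℂ] DSp :=
  if hg : IsBddMeas g then
    LinearMap.mkContinuousOfExistsBound
      { toFun := fun u => (hg.memLp u).toLp _
        map_add' := fun u v => by
          rw [← MemLp.toLp_add]
          refine MemLp.toLp_congr _ _ ?_
          filter_upwards [Lp.coeFn_add u v] with x hx
          change (g x : ℂ) • (u + v : DSp) x = (g x : ℂ) • u x + (g x : ℂ) • v x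
          rw [hx, Pi.add_apply, smul_add]
        map_smul' := fun c u => by
          rw [RingHom.id_apply, ← MemLp.toLp_const_smul]
          refine MemLp.toLp_congr _ _ ?_
          filter_upwards [Lp.coeFn_smul c u] with x hx
          change (g x : ℂ) • (c • u : DSp) x = c • (g x : ℂ) • u x
          rw [hx, Pi.smul_apply, smul_comm] }
      (by
        obtain ⟨-, C, hC⟩ := id hg
        refine ⟨C, fun u => ?_⟩
        refine Lp.norm_le_mul_norm_of_ae_le_mul ?_
        filter_upwards [(hg.memLp u).coeFn_toLp] with x hx
        simp only [LinearMap.coe_mk, AddHom.coe_mk, hx, norm_smul, Complex.norm_real]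
        exact mul_le_mul_of_nonneg_right (hC x) (norm_nonneg _))
  else 0

theorem coeFn_mulOp {g : V3 → ℝ} (hg : IsBddMeas g) (u : DSp) :
    ⇑(mulOp g u) =ᵐ[volume] fun x => (g x : ℂ) • u x := by
  rw [mulOp, dif_pos hg]
  exact (hg.memLp u).coeFn_toLp

theorem norm_mulOp_le {g : V3 → ℝ} (hg : IsBddMeas g) {C : ℝ} (hC : ∀ x, |g x| ≤ C) :
    ‖mulOp g‖ ≤ C := by
  have hC0 : 0 ≤ C := (abs_nonneg _).trans (hC 0)
  refine ContinuousLinearMap.opNorm_le_bound _ hC0 fun u => ?_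
  refine Lp.norm_le_mul_norm_of_ae_le_mul ?_
  filter_upwards [coeFn_mulOp hg u] with x hx
  rw [hx, norm_smul, Complex.norm_real]
  exact mul_le_mul_of_nonneg_right (hC x) (norm_nonneg _)

theorem IsBddMeas.sub {f g : V3 → ℝ} (hf : IsBddMeas f) (hg : IsBddMeas g) :
    IsBddMeas (fun x => f x - g x) := by
  obtain ⟨hf, C, hC⟩ := hf
  obtain ⟨hg, D, hD⟩ := hg
  exact ⟨hf.sub hg, C + D, fun x => (abs_sub _ _).trans (add_le_add (hC x) (hD x))⟩

theorem IsBddMeas.mul {f g : V3 → ℝ} (hf : IsBddMeas f) (hg : IsBddMeas g) :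
    IsBddMeas (fun x => f x * g x) := by
  obtain ⟨hf, C, hC⟩ := hf
  obtain ⟨hg, D, hD⟩ := hg
  refine ⟨hf.mul hg, C * D, fun x => ?_⟩
  rw [abs_mul]
  exact mul_le_mul (hC x) (hD x) (abs_nonneg _) ((abs_nonneg _).trans (hC x))

theorem IsBddMeas.const_mul {g : V3 → ℝ} (hg : IsBddMeas g) (c : ℝ) :
    IsBddMeas (fun x => c * g x) :=
  IsBddMeas.mul ⟨measurable_const, |c|, fun _ => le_rfl⟩ hg

theorem mulOp_sub {f g : V3 → ℝ} (hf : IsBddMeas f) (hg : IsBddMeas g) :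
    mulOp (fun x => f x - g x) = mulOp f - mulOp g := by
  ext u
  filter_upwards [coeFn_mulOp (hf.sub hg) u, coeFn_mulOp hf u, coeFn_mulOp hg u,
    Lp.coeFn_sub (mulOp f u) (mulOp g u)] with x h1 h2 h3 h4
  rw [sub_apply, h4, h1, Pi.sub_apply, h2, h3, Complex.ofReal_sub, sub_smul]

theorem mulOp_mul {f g : V3 → ℝ} (hf : IsBddMeas f) (hg : IsBddMeas g) :
    mulOp (fun x => f x * g x) = mulOp f * mulOp g := by
  ext u
  filter_upwards [coeFn_mulOp (hf.mul hg) u, coeFn_mulOp hf (mulOp g u), coeFn_mulOp hg u]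
    with x h1 h2 h3
  change _ = (mulOp f (mulOp g u)) x
  rw [h1, h2, h3, Complex.ofReal_mul, mul_smul]

theorem mulOp_const_mul {g : V3 → ℝ} (hg : IsBddMeas g) (c : ℝ) :
    mulOp (fun x => c * g x) = c • mulOp g := by
  ext u
  filter_upwards [coeFn_mulOp (hg.const_mul c) u, coeFn_mulOp hg u,
    Lp.coeFn_smul c (mulOp g u)] with x h1 h2 h3
  rw [smul_apply, h3, Pi.smul_apply, h1, h2, Complex.ofReal_mul, mul_smul, Complex.coe_smul]

theorem isSelfAdjoint_mulOp {g : V3 → ℝ} (hg : IsBddMeas g) : IsSelfAdjoint (mulOp g) := by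
  rw [ContinuousLinearMap.isSelfAdjoint_iff_isSymmetric]
  intro u v
  change inner ℂ (mulOp g u) v = inner ℂ u (mulOp g v)
  rw [L2.inner_def, L2.inner_def]
  refine integral_congr_ae ?_
  filter_upwards [coeFn_mulOp hg u, coeFn_mulOp hg v] with x h1 h2
  rw [h1, h2, inner_smul_left, inner_smul_right, Complex.conj_ofReal]

theorem integrable_norm_sq (u : DSp) : Integrable (fun x => ‖u x‖ ^ 2) volume :=
  (Lp.memLp u).integrable_norm_pow two_ne_zero

theorem IsBddMeas.integrable {g : V3 → ℝ} (hg : IsBddMeas g) (u : DSp) :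
    Integrable (fun x => g x * ‖u x‖ ^ 2) volume := by
  obtain ⟨hm, C, hC⟩ := hg
  exact (integrable_norm_sq u).bdd_mul (c := C) hm.aestronglyMeasurable
    (Eventually.of_forall hC)

theorem re_inner_mulOp {g : V3 → ℝ} (hg : IsBddMeas g) (u : DSp) :
    (inner ℂ u (mulOp g u)).re = ∫ x, g x * ‖u x‖ ^ 2 := by
  rw [L2.inner_def]
  have h : ∫ x, (inner ℂ (u x) (mulOp g u x)) = ∫ x, ((g x * ‖u x‖ ^ 2 : ℝ) : ℂ) := by
    refine integral_congr_ae ?_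
    filter_upwards [coeFn_mulOp hg u] with x hx
    rw [hx, inner_smul_right, inner_self_eq_norm_sq_to_K]
    simp
  rw [h, integral_complex_ofReal, Complex.ofReal_re]

theorem norm_sq_eq_integral (u : DSp) : ‖u‖ ^ 2 = ∫ x, ‖u x‖ ^ 2 := by
  have h : (inner ℂ u u).re = ‖u‖ ^ 2 := by
    rw [inner_self_eq_norm_sq_to_K]
    norm_cast
  rw [← h, L2.inner_def]
  simp_rw [inner_self_eq_norm_sq_to_K]
  have : ∀ x, ((‖u x‖ : ℂ)) ^ 2 = ((‖u x‖ ^ 2 : ℝ) : ℂ) := fun x => by norm_cast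
  simp_rw [Complex.coe_algebraMap, this]
  rw [integral_complex_ofReal, Complex.ofReal_re]

theorem hasDerivAt_mulOp {a a' : ℝ → V3 → ℝ} {t L : ℝ} (ht : 0 < t)
    (ha : ∀ s, 0 < s → IsBddMeas (a s)) (ha' : IsBddMeas (a' t))
    (hd : ∀ s, 0 < s → ∀ x, HasDerivAt (fun r => a r x) (a' s x) s)
    (hL : ∀ s, t / 2 ≤ s → ∀ x, |a' s x - a' t x| ≤ L * |s - t|) :
    HasDerivAt (fun s => mulOp (a s)) (mulOp (a' t)) t := by
  have hL0 : 0 ≤ L := by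
    have := (abs_nonneg _).trans (hL (t + 1) (by linarith) 0)
    simpa using this
  have hpt : ∀ s, t / 2 ≤ s → ∀ x, |a s x - a t x - (s - t) * a' t x| ≤ L * (s - t) ^ 2 := by
    intro s hs x
    have hI : ∀ r ∈ Set.uIcc t s, t / 2 ≤ r ∧ |r - t| ≤ |s - t| := fun r hr => by
      refine ⟨?_, Set.abs_sub_left_of_mem_uIcc hr⟩
      exact (le_min (by linarith) hs).trans hr.1
    have h := (convex_uIcc t s).norm_image_sub_le_of_norm_hasDerivWithin_le
      (f := fun r => a r x - r * a' t x) (f' := fun r => a' r x - 1 * a' t x) (C := L * |s - t|)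
      (fun r hr => ((hd r (by linarith [(hI r hr).1]) x).sub
        ((hasDerivAt_id r).mul_const _)).hasDerivWithinAt)
      (fun r hr => by
        rw [one_mul]
        exact (hL r (hI r hr).1 x).trans (mul_le_mul_of_nonneg_left (hI r hr).2 hL0))
      Set.left_mem_uIcc Set.right_mem_uIcc
    rw [Real.norm_eq_abs, Real.norm_eq_abs, mul_assoc, abs_mul_abs_self, ← sq] at h
    convert h using 2
    ring
  rw [hasDerivAt_iff_isLittleO]
  refine Asymptotics.IsBigO.trans_isLittleO (g := fun s => (s - t) ^ 2) ?_ ?_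
  · refine Asymptotics.IsBigO.of_bound L ?_
    filter_upwards [lt_mem_nhds (half_lt_self ht)] with s hs
    have hs0 : 0 < s := by linarith
    rw [← mulOp_sub (ha s hs0) (ha t ht), ← mulOp_const_mul ha',
      ← mulOp_sub ((ha s hs0).sub (ha t ht)) (ha'.const_mul _), Real.norm_of_nonneg (sq_nonneg _)]
    exact norm_mulOp_le (((ha s hs0).sub (ha t ht)).sub (ha'.const_mul _)) (hpt s hs.le)
  · have h1 : Tendsto (fun s : ℝ => s - t) (𝓝 t) (𝓝 0) := by
      have : ContinuousAt (fun s : ℝ => s - t) t := by fun_prop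
      simpa [ContinuousAt] using this
    exact (Asymptotics.isLittleO_pow_id one_lt_two).comp_tendsto h1

end MultiplicationOperator

section GroundState

/-- Minus the logarithmic `t`-derivative of the positive harmonic function
`(t, x) ↦ arctan (‖x‖ / t) / ‖x‖` on the upper half space, in terms of `r = ‖x‖`. -/
def katoV (t r : ℝ) : ℝ := r / ((r ^ 2 + t ^ 2) * Real.arctan (r / t))

/-- The quotient `∂ₜ² w / w` for `w = arctan (‖x‖ / t) / ‖x‖`, in terms of `r = ‖x‖`. -/
def katoG (t r : ℝ) : ℝ := 2 * t / (r ^ 2 + t ^ 2) * katoV t r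

/-- The radial part of `∇ w / w`, divided by `r = ‖x‖`, for `w = arctan (‖x‖ / t) / ‖x‖`. -/
def katoF (t r : ℝ) : ℝ := (t / ((r ^ 2 + t ^ 2) * Real.arctan (r / t)) - 1 / r) / r

/-- The derivative of `katoF` in the radial variable. -/
def katoF' (t r : ℝ) : ℝ :=
  (-(t * (2 * r * Real.arctan (r / t) + t)) / ((r ^ 2 + t ^ 2) * Real.arctan (r / t)) ^ 2 +
    1 / r ^ 2) / r - (t / ((r ^ 2 + t ^ 2) * Real.arctan (r / t)) - 1 / r) / r ^ 2

theorem div_one_add_sq_le_arctan {s : ℝ} (hs : 0 ≤ s) : s / (1 + s ^ 2) ≤ Real.arctan s := by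
  have h1 : Real.sin (2 * Real.arctan s) ≤ 2 * Real.arctan s :=
    Real.sin_le (mul_nonneg zero_le_two (Real.arctan_nonneg.2 hs))
  rw [Real.sin_two_mul, Real.sin_arctan, Real.cos_arctan] at h1
  have h2 : √(1 + s ^ 2) * √(1 + s ^ 2) = 1 + s ^ 2 := Real.mul_self_sqrt (by positivity)
  have h3 : 2 * (s / √(1 + s ^ 2)) * (1 / √(1 + s ^ 2)) = 2 * (s / (1 + s ^ 2)) := by
    rw [mul_assoc, div_mul_div_comm, h2, mul_one]
  rw [h3] at h1
  linarith

theorem katoV_nonneg {t r : ℝ} (ht : 0 < t) (hr : 0 ≤ r) : 0 ≤ katoV t r := by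
  have : 0 ≤ Real.arctan (r / t) := Real.arctan_nonneg.2 (by positivity)
  unfold katoV
  positivity

theorem katoV_le {t r : ℝ} (ht : 0 < t) (hr : 0 ≤ r) : katoV t r ≤ 1 / t := by
  rcases hr.eq_or_lt with rfl | hr
  · simp [katoV, ht.le]
  have h1 := div_one_add_sq_le_arctan (s := r / t) (by positivity)
  have h2 : 0 < Real.arctan (r / t) := Real.arctan_pos.2 (by positivity)
  have h3 : r / t / (1 + (r / t) ^ 2) = r * t / (r ^ 2 + t ^ 2) := by
    field_simp
    ring
  rw [h3, div_le_iff₀ (by positivity)] at h1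
  unfold katoV
  rw [div_le_div_iff₀ (by positivity) ht]
  linarith

theorem katoG_nonneg {t r : ℝ} (ht : 0 < t) (hr : 0 ≤ r) : 0 ≤ katoG t r := by
  have := katoV_nonneg ht hr
  unfold katoG
  positivity

theorem two_mul_div_le {t r : ℝ} (ht : 0 < t) : 2 * t / (r ^ 2 + t ^ 2) ≤ 2 / t := by
  rw [div_le_div_iff₀ (by positivity) ht]
  nlinarith [sq_nonneg r]

theorem katoG_le {t r : ℝ} (ht : 0 < t) (hr : 0 ≤ r) : katoG t r ≤ 2 / t ^ 2 := by
  calc katoG t r ≤ 2 / t * (1 / t) :=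
        mul_le_mul (two_mul_div_le ht) (katoV_le ht hr) (katoV_nonneg ht hr) (by positivity)
    _ = 2 / t ^ 2 := by field_simp

theorem hasDerivAt_arctan_div {t : ℝ} (r : ℝ) (ht : 0 < t) :
    HasDerivAt (fun s => Real.arctan (r / s)) (-r / (r ^ 2 + t ^ 2)) t := by
  have h := ((hasDerivAt_inv ht.ne').const_mul r).arctan
  simp only [← div_eq_mul_inv] at h
  convert h using 1
  field_simp
  ring

theorem hasDerivAt_katoV {t r : ℝ} (ht : 0 < t) (hr : 0 ≤ r) :
    HasDerivAt (fun s => katoV s r) (katoV t r ^ 2 - katoG t r) t := by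
  rcases hr.eq_or_lt with rfl | hr
  · simpa [katoV, katoG] using hasDerivAt_const t (0 : ℝ)
  have h2 : 0 < Real.arctan (r / t) := Real.arctan_pos.2 (by positivity)
  have hne : (r ^ 2 + t ^ 2) * Real.arctan (r / t) ≠ 0 := by positivity
  have h := (hasDerivAt_const t r).div
    (((hasDerivAt_pow 2 t).const_add (r ^ 2)).mul (hasDerivAt_arctan_div r ht)) hne
  refine HasDerivAt.congr_deriv h ?_
  simp only [Pi.mul_apply, katoG, katoV]
  field_simp
  ring

theorem hasDerivAt_katoG {t r : ℝ} (ht : 0 < t) (hr : 0 ≤ r) :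
    HasDerivAt (fun s => katoG s r)
      (2 * (r ^ 2 - t ^ 2) / (r ^ 2 + t ^ 2) ^ 2 * katoV t r +
        2 * t / (r ^ 2 + t ^ 2) * (katoV t r ^ 2 - katoG t r)) t := by
  have h := ((((hasDerivAt_id' t).const_mul 2).div ((hasDerivAt_pow 2 t).const_add (r ^ 2))
    (by positivity))).mul (hasDerivAt_katoV ht hr)
  refine HasDerivAt.congr_deriv h ?_
  simp only [Pi.div_apply]
  congr 2
  field_simp
  ring

theorem abs_katoV_sq_sub_katoG_le {t r : ℝ} (ht : 0 < t) (hr : 0 ≤ r) :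
    |katoV t r ^ 2 - katoG t r| ≤ 3 / t ^ 2 := by
  have h1 := katoV_nonneg ht hr
  have h2 := katoV_le ht hr
  have h3 := katoG_nonneg ht hr
  have h4 := katoG_le ht hr
  have h5 : katoV t r ^ 2 ≤ 1 / t ^ 2 := by
    rw [← one_div_pow]
    gcongr
  have h6 : 3 / t ^ 2 = 1 / t ^ 2 + 2 / t ^ 2 := by ring
  rw [abs_le]
  constructor <;> nlinarith [sq_nonneg (katoV t r)]

theorem abs_deriv_katoV_deriv_le {t r : ℝ} (ht : 0 < t) (hr : 0 ≤ r) :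
    |2 * katoV t r * (katoV t r ^ 2 - katoG t r) -
      (2 * (r ^ 2 - t ^ 2) / (r ^ 2 + t ^ 2) ^ 2 * katoV t r +
        2 * t / (r ^ 2 + t ^ 2) * (katoV t r ^ 2 - katoG t r))| ≤ 14 / t ^ 3 := by
  have h1 := katoV_nonneg ht hr
  have h2 := katoV_le ht hr
  have h3 := abs_katoV_sq_sub_katoG_le ht hr
  have h4 : |2 * (r ^ 2 - t ^ 2) / (r ^ 2 + t ^ 2) ^ 2| ≤ 2 / t ^ 2 := by
    rw [abs_div, abs_mul, abs_of_pos (zero_lt_two' ℝ),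
      abs_of_pos (by positivity : 0 < (r ^ 2 + t ^ 2) ^ 2),
      div_le_div_iff₀ (by positivity) (by positivity)]
    have : |r ^ 2 - t ^ 2| ≤ r ^ 2 + t ^ 2 := by
      rw [abs_le]; constructor <;> nlinarith [sq_nonneg r, sq_nonneg t]
    have h5 : 0 ≤ (r ^ 2 + t ^ 2) * r ^ 2 := by positivity
    have h6 := mul_le_mul_of_nonneg_right this (sq_nonneg t)
    nlinarith
  have h5 : |2 * t / (r ^ 2 + t ^ 2)| ≤ 2 / t := by
    rw [abs_of_nonneg (by positivity)]
    exact two_mul_div_le ht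
  have h6 : |2 * katoV t r * (katoV t r ^ 2 - katoG t r)| ≤ 2 * (1 / t) * (3 / t ^ 2) := by
    rw [abs_mul, abs_of_nonneg (by positivity)]
    gcongr
  have h7 : |2 * (r ^ 2 - t ^ 2) / (r ^ 2 + t ^ 2) ^ 2 * katoV t r| ≤ 2 / t ^ 2 * (1 / t) := by
    rw [abs_mul, abs_of_nonneg h1]
    gcongr
  have h8 : |2 * t / (r ^ 2 + t ^ 2) * (katoV t r ^ 2 - katoG t r)| ≤ 2 / t * (3 / t ^ 2) := by
    rw [abs_mul]
    gcongr
  calc _ ≤ 2 * (1 / t) * (3 / t ^ 2) + (2 / t ^ 2 * (1 / t) + 2 / t * (3 / t ^ 2)) :=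
        (abs_sub _ _).trans (add_le_add h6 ((abs_add_le _ _).trans (add_le_add h7 h8)))
    _ = 14 / t ^ 3 := by
      field_simp
      norm_num

theorem abs_katoV_deriv_sub_le {s t r : ℝ} (ht : 0 < t) (hs : t / 2 ≤ s) (hr : 0 ≤ r) :
    |katoV s r ^ 2 - katoG s r - (katoV t r ^ 2 - katoG t r)| ≤ 112 / t ^ 3 * |s - t| := by
  refine (convex_Ici (t / 2)).norm_image_sub_le_of_norm_hasDerivWithin_le
    (f := fun τ => katoV τ r ^ 2 - katoG τ r)
    (f' := fun τ => 2 * katoV τ r * (katoV τ r ^ 2 - katoG τ r) -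
      (2 * (r ^ 2 - τ ^ 2) / (r ^ 2 + τ ^ 2) ^ 2 * katoV τ r +
        2 * τ / (r ^ 2 + τ ^ 2) * (katoV τ r ^ 2 - katoG τ r))) (fun τ hτ => ?_) (fun τ hτ => ?_)
    (half_le_self ht.le) hs
  · have h0 : 0 < τ := (half_pos ht).trans_le hτ
    have h := ((hasDerivAt_katoV h0 hr).pow 2).sub (hasDerivAt_katoG h0 hr)
    refine HasDerivAt.hasDerivWithinAt (HasDerivAt.congr_deriv h ?_)
    simp
  · have hτ : t / 2 ≤ τ := hτ
    have h0 : 0 < τ := (half_pos ht).trans_le hτ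
    refine (abs_deriv_katoV_deriv_le h0 hr).trans ?_
    have h1 : (t / 2) ^ 3 ≤ τ ^ 3 := by gcongr
    rw [div_le_div_iff₀ (by positivity) (by positivity)]
    nlinarith

theorem measurable_katoV (t : ℝ) : Measurable fun x : V3 => katoV t ‖x‖ := by
  unfold katoV
  fun_prop

theorem isBddMeas_katoV {t : ℝ} (ht : 0 < t) : IsBddMeas fun x : V3 => katoV t ‖x‖ :=
  ⟨measurable_katoV t, 1 / t, fun x => by
    rw [abs_of_nonneg (katoV_nonneg ht (norm_nonneg _))]
    exact katoV_le ht (norm_nonneg _)⟩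

theorem isBddMeas_katoG {t : ℝ} (ht : 0 < t) : IsBddMeas fun x : V3 => katoG t ‖x‖ :=
  ⟨by unfold katoG katoV; fun_prop, 2 / t ^ 2, fun x => by
    rw [abs_of_nonneg (katoG_nonneg ht (norm_nonneg _))]
    exact katoG_le ht (norm_nonneg _)⟩

theorem hasDerivAt_mulOp_katoV {t : ℝ} (ht : 0 < t) :
    HasDerivAt (fun s => mulOp fun x => katoV s ‖x‖)
      (mulOp (fun x => katoV t ‖x‖) * mulOp (fun x => katoV t ‖x‖) -
        mulOp fun x => katoG t ‖x‖) t := by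
  have hV := isBddMeas_katoV ht
  have hG := isBddMeas_katoG ht
  have h := hasDerivAt_mulOp (a := fun s x => katoV s ‖x‖)
    (a' := fun s x => katoV s ‖x‖ * katoV s ‖x‖ - katoG s ‖x‖) (L := 112 / t ^ 3) ht
    (fun s hs => isBddMeas_katoV hs) ((hV.mul hV).sub hG)
    (fun s hs x => by simpa only [← sq] using hasDerivAt_katoV hs (norm_nonneg x))
    (fun s hs x => by simpa only [← sq] using abs_katoV_deriv_sub_le ht hs (norm_nonneg x))
  rwa [mulOp_sub (hV.mul hV) hG, mulOp_mul hV hV] at h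

theorem hasDerivAt_katoF {t r : ℝ} (ht : 0 < t) (hr : 0 < r) :
    HasDerivAt (katoF t) (katoF' t r) r := by
  have h2 : 0 < Real.arctan (r / t) := Real.arctan_pos.2 (by positivity)
  have h1 : HasDerivAt (fun s => Real.arctan (s / t)) (t / (r ^ 2 + t ^ 2)) r := by
    refine HasDerivAt.congr_deriv ((hasDerivAt_id' r).div_const t).arctan ?_
    field_simp
    ring
  have hne : (r ^ 2 + t ^ 2) * Real.arctan (r / t) ≠ 0 := by positivity
  have h3 := ((hasDerivAt_const r t).div (((hasDerivAt_pow 2 r).add_const (t ^ 2)).mul h1)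
    hne).sub ((hasDerivAt_const r (1 : ℝ)).div (hasDerivAt_id' r) hr.ne')
  refine HasDerivAt.congr_deriv (h3.div (hasDerivAt_id' r) hr.ne') ?_
  simp only [Pi.mul_apply, Pi.sub_apply, Pi.div_apply, katoF']
  field_simp
  ring

theorem katoF_identity {t r : ℝ} (ht : 0 < t) (hr : 0 < r) :
    -(3 * katoF t r + r * katoF' t r) - r ^ 2 * katoF t r ^ 2 = katoG t r := by
  have h2 : 0 < Real.arctan (r / t) := Real.arctan_pos.2 (by positivity)
  unfold katoF katoF' katoG katoV
  field_simp
  ring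

theorem continuousOn_katoF' {t : ℝ} (ht : 0 < t) : ContinuousOn (katoF' t) (Set.Ioi 0) := by
  have h2 : ∀ r ∈ Set.Ioi (0 : ℝ), (r ^ 2 + t ^ 2) * Real.arctan (r / t) ≠ 0 := fun r hr => by
    have hr : 0 < r := hr
    have : 0 < Real.arctan (r / t) := Real.arctan_pos.2 (by positivity)
    positivity
  have h3 : ∀ r ∈ Set.Ioi (0 : ℝ), r ≠ 0 := fun r hr => (Set.mem_Ioi.1 hr).ne'
  have h4 : ∀ r ∈ Set.Ioi (0 : ℝ), r ^ 2 ≠ 0 := fun r hr => pow_ne_zero 2 (h3 r hr)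
  have h5 : ∀ r ∈ Set.Ioi (0 : ℝ), ((r ^ 2 + t ^ 2) * Real.arctan (r / t)) ^ 2 ≠ 0 :=
    fun r hr => pow_ne_zero 2 (h2 r hr)
  have hc : Continuous fun r : ℝ => (r ^ 2 + t ^ 2) * Real.arctan (r / t) := by fun_prop
  have hn : Continuous fun r : ℝ => -(t * (2 * r * Real.arctan (r / t) + t)) := by fun_prop
  unfold katoF'
  exact (((hn.continuousOn.div (hc.pow 2).continuousOn h5).add
    (continuousOn_const.div (by fun_prop) h4)).div (by fun_prop) h3).sub
    (((continuousOn_const.div hc.continuousOn h2).sub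
      (continuousOn_const.div (by fun_prop) h3)).div (by fun_prop) h4)

theorem tendsto_katoV {r : ℝ} (hr : 0 < r) :
    Tendsto (fun t => katoV t r) (𝓝[>] 0) (𝓝 (2 / Real.pi / r)) := by
  have h1 : Tendsto (fun t => r / t) (𝓝[>] (0 : ℝ)) atTop :=
    Tendsto.const_mul_atTop hr tendsto_inv_nhdsGT_zero
  have h2 := (Real.tendsto_arctan_atTop.mono_right nhdsWithin_le_nhds).comp h1
  have h3 : Tendsto (fun t : ℝ => r ^ 2 + t ^ 2) (𝓝[>] 0) (𝓝 (r ^ 2 + 0 ^ 2)) :=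
    (by fun_prop : Continuous fun t : ℝ => r ^ 2 + t ^ 2).continuousAt.tendsto.mono_left
      nhdsWithin_le_nhds
  have h4 : (r ^ 2 + 0 ^ 2) * (Real.pi / 2) ≠ 0 := by positivity
  have h := (tendsto_const_nhds (x := r)).div (h3.mul h2) h4
  have e : r / ((r ^ 2 + 0 ^ 2) * (Real.pi / 2)) = 2 / Real.pi / r := by
    have := Real.pi_pos
    field_simp
    ring
  rw [e] at h
  exact h

end GroundState

section Pointwise

/-- The spin matrices `diag(σ_l, σ_l) = -i α_{l+1} α_{l+2}`. -/
def spinMat (l : Fin 3) : Matrix (Fin 4) (Fin 4) ℂ :=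
  -Complex.I • (diracα (l + 1) * diracα (l + 2))

theorem real_inner_C4 (ξ η : C4) : inner ℝ ξ η =
    ∑ i, ((ξ i).re * (η i).re + (ξ i).im * (η i).im) := by
  rw [PiLp.inner_apply]
  refine Finset.sum_congr rfl fun i _ => ?_
  rw [Complex.inner]
  simp
  ring

theorem norm_sq_C4 (ξ : C4) : ‖ξ‖ ^ 2 = ∑ i, ((ξ i).re ^ 2 + (ξ i).im ^ 2) := by
  rw [← real_inner_self_eq_norm_sq, real_inner_C4]
  simp only [sq]

theorem mapp_apply (M : Matrix (Fin 4) (Fin 4) ℂ) (ξ : C4) (i : Fin 4) :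
    mapp M ξ i = ∑ j, M i j * ξ j := rfl

theorem norm_sq_diracActA_eq (ξ : C4) (η : Fin 3 → C4) (a : Fin 3 → ℝ) :
    ‖mapp diracβ ξ - Complex.I • ∑ j, mapp (diracα j) (η j) -
        ∑ j, (a j : ℂ) • mapp (diracα j) ξ‖ ^ 2 =
      ‖ξ‖ ^ 2 + ∑ j, ‖η j - (Complex.I * a j) • ξ‖ ^ 2 +
        ∑ j, 2 * inner ℝ ξ (mapp (-Complex.I • (diracβ * diracα j)) (η j)) +
        ∑ l, (2 * inner ℝ (η (l + 1)) (mapp (diracα (l + 1) * diracα (l + 2)) (η (l + 2))) +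
          (a (l + 2) * (2 * inner ℝ ξ (mapp (spinMat l) (η (l + 1)))) -
            a (l + 1) * (2 * inner ℝ ξ (mapp (spinMat l) (η (l + 2)))))) := by
  have h1 : (1 : Fin 3) + 1 = 2 := rfl
  have h2 : (1 : Fin 3) + 2 = 0 := rfl
  have h3 : (2 : Fin 3) + 1 = 0 := rfl
  have h4 : (2 : Fin 3) + 2 = 1 := rfl
  simp only [norm_sq_C4, real_inner_C4, Fin.sum_univ_three, Fin.sum_univ_four, spinMat, zero_add,
    h1, h2, h3, h4]
  simp [mapp_apply, Fin.sum_univ_four, diracα, diracβ]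
  ring

end Pointwise

section IntegrationByParts

theorem integrable_fderiv_apply {φ : V3 → ℝ} (hφ : ContDiff ℝ 1 φ) (hc : HasCompactSupport φ)
    (v : V3) : Integrable (fun x => fderiv ℝ φ x v) volume :=
  ((hφ.continuous_fderiv one_ne_zero).clm_apply continuous_const).integrable_of_hasCompactSupport
    (hc.fderiv_apply ℝ v)

theorem integral_fderiv_apply_eq_zero {φ : V3 → ℝ} (hφ : ContDiff ℝ 1 φ)
    (hc : HasCompactSupport φ) (v : V3) : ∫ x, fderiv ℝ φ x v = 0 := by
  have h := integral_mul_fderiv_eq_neg_fderiv_mul_of_integrable (μ := (volume : Measure V3))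
    (f := fun _ => (1 : ℝ)) (g := φ) (v := v) (by simp)
    (by simpa using integrable_fderiv_apply hφ hc v)
    (by simpa using hφ.continuous.integrable_of_hasCompactSupport hc)
    (fun x _ => differentiableAt_const _) (fun x _ => hφ.differentiable one_ne_zero x)
  simpa using h

/-- Application of a matrix to spinors, as a real-linear operator. -/
def mappL (M : Matrix (Fin 4) (Fin 4) ℂ) : C4 →L[ℝ] C4 :=
  LinearMap.toContinuousLinearMap
    { toFun := mapp M
      map_add' := fun x y => by
        ext i
        simp [mapp_apply, mul_add, Finset.sum_add_distrib]
      map_smul' := fun c x => by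
        ext i
        simp only [mapp_apply, PiLp.smul_apply, Complex.real_smul, Finset.mul_sum, RingHom.id_apply]
        exact Finset.sum_congr rfl fun j _ => by ring }

theorem mappL_apply (M : Matrix (Fin 4) (Fin 4) ℂ) (ξ : C4) : mappL M ξ = mapp M ξ := rfl

theorem inner_mapp_left (M : Matrix (Fin 4) (Fin 4) ℂ) (ξ η : C4) :
    inner ℝ (mapp M ξ) η = inner ℝ ξ (mapp M.conjTranspose η) := by
  simp only [real_inner_C4, Fin.sum_univ_four, mapp_apply, Matrix.conjTranspose_apply]
  simp
  ring

theorem contDiff_inner_mapp {n : WithTop ℕ∞} {f g : V3 → C4} (hf : ContDiff ℝ n f)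
    (hg : ContDiff ℝ n g) (M : Matrix (Fin 4) (Fin 4) ℂ) :
    ContDiff ℝ n fun x => inner ℝ (f x) (mapp M (g x)) :=
  hf.inner ℝ ((mappL M).contDiff.comp hg)

theorem fderiv_inner_mapp {f g : V3 → C4} {x : V3} (hf : DifferentiableAt ℝ f x)
    (hg : DifferentiableAt ℝ g x) (M : Matrix (Fin 4) (Fin 4) ℂ) (v : V3) :
    fderiv ℝ (fun x => inner ℝ (f x) (mapp M (g x))) x v =
      inner ℝ (f x) (mapp M (fderiv ℝ g x v)) + inner ℝ (fderiv ℝ f x v) (mapp M (g x)) := by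
  have h := (hf.hasFDerivAt.inner ℝ ((mappL M).hasFDerivAt.comp x hg.hasFDerivAt)).fderiv
  have h' := DFunLike.congr_fun h v
  simpa [mappL_apply] using h'

theorem fderiv_inner_mapp_self {f : V3 → C4} {x : V3} (hf : DifferentiableAt ℝ f x)
    {M : Matrix (Fin 4) (Fin 4) ℂ} (hM : M.conjTranspose = M) (v : V3) :
    fderiv ℝ (fun x => inner ℝ (f x) (mapp M (f x))) x v =
      2 * inner ℝ (f x) (mapp M (fderiv ℝ f x v)) := by
  rw [fderiv_inner_mapp hf hf, real_inner_comm (mapp M (f x)), inner_mapp_left, hM]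
  ring

theorem hasCompactSupport_inner_mapp {f : V3 → C4} (hf : HasCompactSupport f) (g : V3 → C4)
    (M : Matrix (Fin 4) (Fin 4) ℂ) :
    HasCompactSupport fun x => inner ℝ (f x) (mapp M (g x)) :=
  hf.mono fun x hx h => hx (by simp [h])

theorem fderiv_fderiv_apply_comm {f : V3 → C4} (hf : ContDiff ℝ 2 f) (x v w : V3) :
    fderiv ℝ (fun y => fderiv ℝ f y w) x v = fderiv ℝ (fun y => fderiv ℝ f y v) x w := by
  have hd : DifferentiableAt ℝ (fderiv ℝ f) x :=
    (hf.fderiv_right (m := 1) (by norm_num)).differentiable one_ne_zero x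
  have hs : IsSymmSndFDerivAt ℝ f x := hf.contDiffAt.isSymmSndFDerivAt (by simp)
  have h : ∀ u u' : V3, fderiv ℝ (fun y => fderiv ℝ f y u) x u' = fderiv ℝ (fderiv ℝ f) x u' u := by
    intro u u'
    rw [fderiv_clm_apply hd (differentiableAt_const u)]
    simp
  rw [h, h, hs]

theorem integral_inner_fderiv_skew {f : V3 → C4} (hf : ContDiff ℝ 2 f)
    (hc : HasCompactSupport f) {N : Matrix (Fin 4) (Fin 4) ℂ} (hN : N.conjTranspose = -N)
    (v w : V3) :
    Integrable (fun x => 2 * inner ℝ (fderiv ℝ f x v) (mapp N (fderiv ℝ f x w))) volume ∧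
      ∫ x, 2 * inner ℝ (fderiv ℝ f x v) (mapp N (fderiv ℝ f x w)) = 0 := by
  have hd : ∀ u : V3, ContDiff ℝ 1 fun x => fderiv ℝ f x u := fun u =>
    (hf.fderiv_right (m := 1) (by norm_num)).clm_apply contDiff_const
  have hf1 : ContDiff ℝ 1 f := hf.of_le (by norm_num)
  have h1 := contDiff_inner_mapp hf1 (hd w) N
  have h2 := contDiff_inner_mapp (hd v) hf1 N
  have c1 := hasCompactSupport_inner_mapp hc (fun x => fderiv ℝ f x w) N
  have c2 := hasCompactSupport_inner_mapp (hc.fderiv_apply ℝ v) f N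
  have e : ∀ x, 2 * inner ℝ (fderiv ℝ f x v) (mapp N (fderiv ℝ f x w)) =
      fderiv ℝ (fun x => inner ℝ (f x) (mapp N (fderiv ℝ f x w))) x v +
        fderiv ℝ (fun x => inner ℝ (fderiv ℝ f x v) (mapp N (f x))) x w := by
    intro x
    rw [fderiv_inner_mapp (hf1.differentiable one_ne_zero x)
        ((hd w).differentiable one_ne_zero x),
      fderiv_inner_mapp ((hd v).differentiable one_ne_zero x)
        (hf1.differentiable one_ne_zero x), fderiv_fderiv_apply_comm hf x w v,
      real_inner_comm (mapp N (f x)), inner_mapp_left, hN]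
    have : ∀ ξ : C4, mapp (-N) ξ = -mapp N ξ := fun ξ => by
      ext i
      simp [mapp_apply]
    rw [this, inner_neg_right]
    ring
  simp only [e]
  exact ⟨(integrable_fderiv_apply h1 c1 v).add (integrable_fderiv_apply h2 c2 w), by
    rw [integral_add (integrable_fderiv_apply h1 c1 v) (integrable_fderiv_apply h2 c2 w),
      integral_fderiv_apply_eq_zero h1 c1, integral_fderiv_apply_eq_zero h2 c2, add_zero]⟩

end IntegrationByParts

section Potential

theorem aemeasurable_of_mul {q : V3 → ℝ} {g : ℕ → V3 → ℝ} (hg : ∀ n, Measurable (g n))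
    (hgq : ∀ n, AEMeasurable (fun x => g n x * q x) volume)
    (hU : ∀ᵐ x ∂(volume : Measure V3), ∃ n, g n x ≠ 0) : AEMeasurable q volume := by
  have hs : ∀ n, MeasurableSet {x | g n x ≠ 0} := fun n => (hg n) (measurableSet_singleton 0).compl
  rw [← Measure.restrict_eq_self_of_ae_mem (μ := (volume : Measure V3))
    (s := ⋃ n, {x | g n x ≠ 0}) (by simpa using hU), aemeasurable_iUnion_iff]
  intro n
  refine (((hgq n).div (hg n).aemeasurable).restrict (s := {x | g n x ≠ 0})).congr ?_
  filter_upwards [ae_restrict_mem (hs n)] with x hx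
  exact mul_div_cancel_left₀ (q x) hx

theorem IsTestFn.exists_Lp {f : V3 → C4} (hf : IsTestFn f) : ∃ u : DSp, ⇑u =ᵐ[volume] f :=
  ⟨(hf.1.continuous.memLp_of_hasCompactSupport hf.2).toLp f, MemLp.coeFn_toLp _⟩

theorem IsMagneticDirac.aestronglyMeasurable_diracActA {A : V3 → V3} {HA : DSp →ₗ.[ℂ] DSp}
    (hHA : IsMagneticDirac A HA) {f : V3 → C4} (hf : IsTestFnAway f) :
    AEStronglyMeasurable (diracActA A f) volume := by
  obtain ⟨u, hu⟩ := IsTestFn.exists_Lp ⟨hf.1, hf.2.1⟩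
  obtain ⟨hd, h⟩ := hHA.2.2 u f hf hu
  exact (Lp.aestronglyMeasurable _).congr h

theorem IsMagneticDirac.aemeasurable_mul {A : V3 → V3} {HA : DSp →ₗ.[ℂ] DSp}
    (hHA : IsMagneticDirac A HA) {g : V3 → ℝ} (hg : ContDiff ℝ (⊤ : ℕ∞) g)
    (hc : HasCompactSupport g) (h0 : (0 : V3) ∉ tsupport g) (j : Fin 3) :
    AEMeasurable (fun x => g x * A x j) volume := by
  set f : V3 → C4 := fun x => g x • EuclideanSpace.single 0 (1 : ℂ) with hfdef
  have hsub : tsupport f ⊆ tsupport g := closure_mono fun x hx h => hx (by simp [hfdef, h])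
  have hf : IsTestFnAway f := ⟨hg.smul contDiff_const,
    hc.mono fun x hx h => hx (by simp [hfdef, h]),
    fun h => h0 (hsub h)⟩
  have hm := hHA.aestronglyMeasurable_diracActA hf
  have hfd : ∀ v : V3, Continuous fun x => fderiv ℝ f x v := fun v =>
    (hf.1.continuous_fderiv (by simp)).clm_apply continuous_const
  have hcont : ∀ M, ∀ F : V3 → C4, Continuous F → Continuous fun x => mapp M (F x) :=
    fun M F hF => (mappL M).continuous.comp hF
  have hm2 : AEMeasurable (fun x => mapp diracβ (f x) - Complex.I • ∑ j : Fin 3,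
      mapp (diracα j) (fderiv ℝ f x (EuclideanSpace.single j (1 : ℝ))) -
      diracActA A f x) volume := by
    refine AEMeasurable.sub (Continuous.aemeasurable ?_) hm.aemeasurable
    exact (hcont _ _ hf.1.continuous).sub (continuous_const_smul (Complex.I) |>.comp
      (continuous_finsetSum _ fun j _ => hcont _ _ (hfd _)))
  have e : ∀ x, mapp diracβ (f x) - Complex.I • ∑ j : Fin 3,
      mapp (diracα j) (fderiv ℝ f x (EuclideanSpace.single j (1 : ℝ))) - diracActA A f x =
      ∑ j : Fin 3, (A x j : ℂ) • mapp (diracα j) (f x) := fun x => by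
    simp [diracActA]
  simp only [e] at hm2
  have hco : ∀ i : Fin 4, AEMeasurable (fun x => (∑ j : Fin 3,
      (A x j : ℂ) • mapp (diracα j) (f x)) i) volume := fun i =>
    (PiLp.continuous_apply 2 (fun _ : Fin 4 => ℂ) i).measurable.comp_aemeasurable
      hm2
  have h2 := Complex.measurable_re.comp_aemeasurable (hco 2)
  have h3 := Complex.measurable_re.comp_aemeasurable (hco 3)
  have h4 := Complex.measurable_im.comp_aemeasurable (hco 3)
  fin_cases j
  · refine h3.congr (ae_of_all _ fun x => ?_)
    simp [Fin.sum_univ_three, mapp_apply, diracα, hfdef]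
    ring
  · refine h4.congr (ae_of_all _ fun x => ?_)
    simp [Fin.sum_univ_three, mapp_apply, diracα, hfdef]
    ring
  · refine h2.congr (ae_of_all _ fun x => ?_)
    simp [Fin.sum_univ_three, mapp_apply, diracα, hfdef]
    ring

theorem IsMagneticDirac.aemeasurable {A : V3 → V3} {HA : DSp →ₗ.[ℂ] DSp}
    (hHA : IsMagneticDirac A HA) (j : Fin 3) : AEMeasurable (fun x => A x j) volume := by
  have hU : ∀ n : ℕ, IsOpen {x : V3 | 1 / ((n : ℝ) + 1) < ‖x‖ ∧ ‖x‖ < n + 1} := fun n =>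
    (isOpen_lt continuous_const continuous_norm).inter (isOpen_lt continuous_norm continuous_const)
  choose g hgs hg _ using fun n => (hU n).exists_contDiff_support_eq (n := ⊤)
  have hcl : ∀ n, tsupport (g n) ⊆ {x : V3 | 1 / ((n : ℝ) + 1) ≤ ‖x‖ ∧ ‖x‖ ≤ n + 1} := by
    intro n
    refine closure_minimal ?_ ((isClosed_le continuous_const continuous_norm).inter
      (isClosed_le continuous_norm continuous_const))
    rw [hgs]
    exact fun x hx => ⟨hx.1.le, hx.2.le⟩
  refine aemeasurable_of_mul (fun n => (hg n).continuous.measurable)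
    (fun n => hHA.aemeasurable_mul (hg n) ?_ (fun h => ?_) j) ?_
  · refine HasCompactSupport.intro (isCompact_closedBall (0 : V3) (n + 1)) fun x hx => ?_
    by_contra h
    exact hx (by simpa using (hcl n (subset_closure h)).2)
  · have h1 := (hcl n h).1
    rw [norm_zero] at h1
    exact absurd h1 (not_le.2 (by positivity))
  · filter_upwards [compl_mem_ae_iff.2 (measure_singleton (0 : V3))] with x hx
    obtain ⟨n, hn⟩ := exists_nat_gt (max ‖x‖ (1 / ‖x‖))
    have hx0 : 0 < ‖x‖ := norm_pos_iff.2 hx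
    have h1 : ‖x‖ < n := (le_max_left _ _).trans_lt hn
    have h2 : 1 / ‖x‖ < n := (le_max_right _ _).trans_lt hn
    refine ⟨n, ?_⟩
    have : x ∈ Function.support (g n) := by
      rw [hgs]
      refine ⟨?_, by linarith⟩
      rw [div_lt_iff₀ hx0] at h2
      rw [div_lt_iff₀ (by positivity)]
      nlinarith
    exact this

theorem IsMagneticDirac.locallyIntegrable {A : V3 → V3} {HA : DSp →ₗ.[ℂ] DSp}
    (hHA : IsMagneticDirac A HA) (hA : LocallyIntegrable (fun x : V3 => ‖A x‖ ^ 3) volume)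
    (j : Fin 3) : LocallyIntegrable (fun x => A x j) volume := by
  refine ((locallyIntegrable_const (1 : ℝ)).add hA).mono (hHA.aemeasurable j).aestronglyMeasurable
    (ae_of_all _ fun x => ?_)
  have h1 : ‖A x j‖ ≤ ‖A x‖ := PiLp.norm_apply_le _ _
  have h2 : 0 ≤ ‖A x‖ := norm_nonneg _
  have h3 : ‖A x‖ ≤ 1 + ‖A x‖ ^ 3 := by
    rcases le_total ‖A x‖ 1 with h | h
    · have := pow_nonneg h2 3
      linarith
    · have := le_self_pow₀ h (n := 3) (by norm_num)
      linarith
  simp only [Pi.add_apply, Real.norm_eq_abs] at *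
  rw [abs_of_nonneg (by positivity : 0 ≤ 1 + ‖A x‖ ^ 3)]
  linarith

theorem integrable_mul_fderiv {a : V3 → ℝ} (ha : LocallyIntegrable a volume) {φ : V3 → ℝ}
    (hφ : ContDiff ℝ (⊤ : ℕ∞) φ) (hc : HasCompactSupport φ) (v : V3) :
    Integrable (fun x => a x * fderiv ℝ φ x v) volume :=
  ha.integrable_smul_right_of_hasCompactSupport
    ((hφ.continuous_fderiv (by simp)).clm_apply continuous_const) (hc.fderiv_apply ℝ v)

theorem IsCurlOf.exists_aemeasurable {A Bfun : V3 → V3} (hcurl : IsCurlOf A Bfun)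
    (hA : ∀ j : Fin 3, LocallyIntegrable (fun x => A x j) volume) (l : Fin 3) :
    ∃ b : V3 → ℝ, AEMeasurable b volume ∧ (∀ x, b x = Bfun x l ∨ b x = 0) ∧
      ∀ φ : V3 → ℝ, ContDiff ℝ (⊤ : ℕ∞) φ → HasCompactSupport φ →
        ∫ x, b x * φ x = ∫ x, (A x (l + 1) * fderiv ℝ φ x (EuclideanSpace.single (l + 2) (1 : ℝ)) -
          A x (l + 2) * fderiv ℝ φ x (EuclideanSpace.single (l + 1) (1 : ℝ))) := by
  by_cases h : ∀ φ : V3 → ℝ, ContDiff ℝ (⊤ : ℕ∞) φ → HasCompactSupport φ →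
    ∫ x, Bfun x l * φ x = 0
  · refine ⟨fun _ => 0, aemeasurable_const, fun x => Or.inr rfl, fun φ hφ hc => ?_⟩
    rw [← hcurl l φ hφ hc, h φ hφ hc]
    simp
  push Not at h
  obtain ⟨φ, hφ, hc, hne⟩ := h
  refine ⟨fun x => Bfun x l, ?_, fun x => Or.inl rfl, hcurl l⟩
  have key : ∀ ψ : V3 → ℝ, ContDiff ℝ (⊤ : ℕ∞) ψ → HasCompactSupport ψ →
      Integrable (fun x => Bfun x l * ψ x) volume := by
    intro ψ hψ hcψ
    by_contra hni
    have h0 : ∫ x, Bfun x l * ψ x = 0 := integral_undef hni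
    have hs : ∫ x, Bfun x l * (ψ x + φ x) ≠ 0 := by
      rw [hcurl l _ (hψ.add hφ) (hcψ.add hc)]
      have e : ∀ x v, fderiv ℝ (fun x => ψ x + φ x) x v = fderiv ℝ ψ x v + fderiv ℝ φ x v := by
        intro x v
        rw [fderiv_fun_add (hψ.differentiable (by simp) x) (hφ.differentiable (by simp) x)]
        rfl
      have e2 : ∀ x, A x (l + 1) * fderiv ℝ (fun x => ψ x + φ x) x
            (EuclideanSpace.single (l + 2) (1 : ℝ)) -
          A x (l + 2) * fderiv ℝ (fun x => ψ x + φ x) x (EuclideanSpace.single (l + 1) (1 : ℝ)) =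
          (A x (l + 1) * fderiv ℝ ψ x (EuclideanSpace.single (l + 2) (1 : ℝ)) -
            A x (l + 2) * fderiv ℝ ψ x (EuclideanSpace.single (l + 1) (1 : ℝ))) +
          (A x (l + 1) * fderiv ℝ φ x (EuclideanSpace.single (l + 2) (1 : ℝ)) -
            A x (l + 2) * fderiv ℝ φ x (EuclideanSpace.single (l + 1) (1 : ℝ))) := by
        intro x
        rw [e, e]
        ring
      have hint : ∀ η : V3 → ℝ, ContDiff ℝ (⊤ : ℕ∞) η → HasCompactSupport η → Integrable (fun x =>
          A x (l + 1) * fderiv ℝ η x (EuclideanSpace.single (l + 2) (1 : ℝ)) -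
            A x (l + 2) * fderiv ℝ η x (EuclideanSpace.single (l + 1) (1 : ℝ))) volume :=
        fun η hη hcη => (integrable_mul_fderiv (hA _) hη hcη _).sub
          (integrable_mul_fderiv (hA _) hη hcη _)
      simp only [e2]
      rw [integral_add (hint ψ hψ hcψ) (hint φ hφ hc), ← hcurl l ψ hψ hcψ, ← hcurl l φ hφ hc, h0,
        zero_add]
      exact hne
    have h1 : Integrable (fun x => Bfun x l * (ψ x + φ x)) volume :=
      Classical.not_not.1 fun hh => hs (integral_undef hh)
    have h2 : Integrable (fun x => Bfun x l * φ x) volume :=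
      Classical.not_not.1 fun hh => hne (integral_undef hh)
    refine hni ((h1.sub h2).congr (ae_of_all _ fun x => ?_))
    simp only [Pi.sub_apply]
    ring
  have hU : ∀ n : ℕ, IsOpen {x : V3 | ‖x‖ < n} := fun n =>
    isOpen_lt continuous_norm continuous_const
  choose g hgs hg _ using fun n => (hU n).exists_contDiff_support_eq (n := ⊤)
  refine aemeasurable_of_mul (fun n => (hg n).continuous.measurable) (fun n => ?_)
    (ae_of_all _ fun x => ?_)
  · have hcg : HasCompactSupport (g n) := by
      refine HasCompactSupport.intro (isCompact_closedBall (0 : V3) n) fun x hx => ?_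
      by_contra h
      have : x ∈ Function.support (g n) := h
      rw [hgs] at this
      exact hx (by simpa using (show ‖x‖ < n from this).le)
    refine (key (g n) (hg n) hcg).aemeasurable.congr (ae_of_all _ fun x => mul_comm _ _)
  · obtain ⟨n, hn⟩ := exists_nat_gt ‖x‖
    refine ⟨n, ?_⟩
    have : x ∈ Function.support (g n) := by
      rw [hgs]
      exact hn
    exact this

theorem abs_sum_mul_inner_spinMat_le (b : V3) (ξ : C4) :
    |∑ l, b l * inner ℝ ξ (mapp (spinMat l) ξ)| ≤ ‖b‖ * ‖ξ‖ ^ 2 := by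
  set ζ : C4 := ∑ l, b l • mapp (spinMat l) ξ with hζ
  have h1 : ∑ l, b l * inner ℝ ξ (mapp (spinMat l) ξ) = inner ℝ ξ ζ := by
    rw [hζ, inner_sum]
    simp only [inner_smul_right]
  have h2 : ‖ζ‖ ^ 2 = (‖b‖ * ‖ξ‖) ^ 2 := by
    have hh2 : (1 : Fin 3) + 1 = 2 := rfl
    have hh3 : (1 : Fin 3) + 2 = 0 := rfl
    have hh4 : (2 : Fin 3) + 1 = 0 := rfl
    have hh5 : (2 : Fin 3) + 2 = 1 := rfl
    rw [mul_pow, EuclideanSpace.norm_sq_eq b, norm_sq_C4, norm_sq_C4, hζ]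
    simp only [Fin.sum_univ_three, Fin.sum_univ_four, spinMat, zero_add, hh2, hh3, hh4, hh5]
    simp [mapp_apply, Fin.sum_univ_four, diracα]
    ring
  have h3 : ‖ζ‖ = ‖b‖ * ‖ξ‖ := by
    rwa [sq_eq_sq₀ (norm_nonneg _) (by positivity)] at h2
  rw [h1]
  calc _ ≤ ‖ξ‖ * ‖ζ‖ := abs_real_inner_le_norm _ _
    _ = ‖b‖ * ‖ξ‖ ^ 2 := by rw [h3]; ring

end Potential

section Hardy

theorem hasFDerivAt_norm_of_ne {x : V3} (hx : x ≠ 0) :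
    HasFDerivAt (fun y : V3 => ‖y‖) (‖x‖⁻¹ • innerSL ℝ x) x := by
  have h0 : ‖x‖ ≠ 0 := norm_ne_zero_iff.2 hx
  have h := (hasStrictFDerivAt_norm_sq x).hasFDerivAt.sqrt (pow_ne_zero 2 h0)
  simp only [Real.sqrt_sq (norm_nonneg _)] at h
  refine h.congr_fderiv ?_
  ext v
  simp
  field_simp

theorem fderiv_radial_mul {α : ℝ → ℝ} {a : ℝ} {x : V3} (hx : x ≠ 0) (hα : HasDerivAt α a ‖x‖)
    {f : V3 → C4} (hf : DifferentiableAt ℝ f x) (j : Fin 3) :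
    fderiv ℝ (fun y : V3 => α ‖y‖ * y j * ‖f y‖ ^ 2) x (EuclideanSpace.single j (1 : ℝ)) =
      (a * ‖x‖⁻¹ * x j ^ 2 + α ‖x‖) * ‖f x‖ ^ 2 +
        α ‖x‖ * x j * (2 * inner ℝ (f x) (fderiv ℝ f x (EuclideanSpace.single j (1 : ℝ)))) := by
  have h1 := hα.comp_hasFDerivAt x (hasFDerivAt_norm_of_ne hx)
  have h2 : HasFDerivAt (fun y : V3 => y j) (EuclideanSpace.proj (𝕜 := ℝ) j : V3 →L[ℝ] ℝ) x :=
    (EuclideanSpace.proj (𝕜 := ℝ) j : V3 →L[ℝ] ℝ).hasFDerivAt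
  have h := ((h1.mul h2).mul hf.hasFDerivAt.norm_sq).fderiv
  have h' := DFunLike.congr_fun h (EuclideanSpace.single j (1 : ℝ))
  simp [EuclideanSpace.inner_single_right] at h'
  refine h'.trans ?_
  ring

theorem contDiff_radial_mul {α α' : ℝ → ℝ} (hα : ∀ r, 0 < r → HasDerivAt α (α' r) r)
    (hα' : ContinuousOn α' (Set.Ioi 0)) {f : V3 → C4} (hf : IsTestFnAway f) (j : Fin 3) :
    ContDiff ℝ 1 fun y : V3 => α ‖y‖ * y j * ‖f y‖ ^ 2 := by
  have hαc : ContDiffOn ℝ 1 α (Set.Ioi 0) := by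
    rw [contDiffOn_one_iff_derivWithin (uniqueDiffOn_Ioi 0)]
    refine ⟨fun r hr => (hα r hr).differentiableAt.differentiableWithinAt, hα'.congr fun r hr => ?_⟩
    exact (hα r hr).hasDerivWithinAt.derivWithin (uniqueDiffOn_Ioi 0 r hr)
  rw [contDiff_iff_contDiffAt]
  intro x
  by_cases hx : x = 0
  · have h : (fun y : V3 => α ‖y‖ * y j * ‖f y‖ ^ 2) =ᶠ[𝓝 x] fun _ => 0 := by
      filter_upwards [(notMem_tsupport_iff_eventuallyEq.1 (hx ▸ hf.2.2 : x ∉ tsupport f))] with y hy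
      simp [hy]
    exact contDiffAt_const.congr_of_eventuallyEq h
  · have h1 : ContDiffAt ℝ 1 α ‖x‖ := hαc.contDiffAt (Ioi_mem_nhds (norm_pos_iff.2 hx))
    have h2 : ContDiffAt ℝ 1 (fun y : V3 => y j) x :=
      (EuclideanSpace.proj (𝕜 := ℝ) j : V3 →L[ℝ] ℝ).contDiff.contDiffAt
    have h3 : ContDiffAt ℝ 1 f x := (hf.1.of_le (by exact_mod_cast le_top)).contDiffAt
    exact ((h1.comp x (contDiffAt_norm ℝ hx)).mul h2).mul (h3.norm_sq ℝ)

theorem conjTranspose_spinMat (l : Fin 3) : (spinMat l).conjTranspose = spinMat l := by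
  ext i k
  fin_cases l <;> fin_cases i <;> fin_cases k <;>
    simp [spinMat, diracα]

theorem conjTranspose_beta_alpha (j : Fin 3) :
    (-Complex.I • (diracβ * diracα j)).conjTranspose = -Complex.I • (diracβ * diracα j) := by
  ext i k
  fin_cases j <;> fin_cases i <;> fin_cases k <;>
    simp [diracβ, diracα]

theorem conjTranspose_alpha_alpha (l : Fin 3) :
    (diracα (l + 1) * diracα (l + 2)).conjTranspose = -(diracα (l + 1) * diracα (l + 2)) := by
  ext i k
  fin_cases l <;> fin_cases i <;> fin_cases k <;>
    simp [diracα]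

end Hardy

section Core

local notation "e" j => (EuclideanSpace.single (j : Fin 3) (1 : ℝ) : V3)

theorem two_mul_inner_sub_le (ξ η : C4) (a F : ℝ) :
    F * (2 * inner ℝ ξ η) - F ^ 2 * ‖ξ‖ ^ 2 ≤ ‖η - (Complex.I * a) • ξ‖ ^ 2 := by
  have h0 : inner ℝ ξ ((Complex.I * a) • ξ) = 0 := by
    rw [real_inner_C4]
    refine Finset.sum_eq_zero fun i _ => ?_
    simp
    ring
  have h := sq_nonneg ‖(η - (Complex.I * a) • ξ) - F • ξ‖
  rw [norm_sub_sq_real (η - (Complex.I * a) • ξ), inner_smul_right, inner_sub_left,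
    real_inner_comm ξ η, real_inner_comm ξ ((Complex.I * a) • ξ), h0, norm_smul, mul_pow,
    Real.norm_eq_abs, sq_abs] at h
  linarith

theorem radial_mul_norm_sq_le {A : V3 → V3} {α : ℝ → ℝ} {a c : ℝ} {f : V3 → C4} {x : V3}
    (hx : x ≠ 0) (hα : HasDerivAt α a ‖x‖) (hf : DifferentiableAt ℝ f x)
    (hc : c ≤ -(3 * α ‖x‖ + ‖x‖ * a) - ‖x‖ ^ 2 * α ‖x‖ ^ 2) :
    c * ‖f x‖ ^ 2 ≤ ‖diracActA A f x‖ ^ 2 -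
      ∑ j, fderiv ℝ (fun y : V3 => α ‖y‖ * y j * ‖f y‖ ^ 2) x (e j) -
      ∑ j, fderiv ℝ (fun y => inner ℝ (f y) (mapp (-Complex.I • (diracβ * diracα j)) (f y))) x (e j) -
      ∑ l, 2 * inner ℝ (fderiv ℝ f x (e (l + 1)))
        (mapp (diracα (l + 1) * diracα (l + 2)) (fderiv ℝ f x (e (l + 2)))) +
      ∑ l, (A x (l + 1) * fderiv ℝ (fun y => inner ℝ (f y) (mapp (spinMat l) (f y))) x (e (l + 2)) -
        A x (l + 2) * fderiv ℝ (fun y => inner ℝ (f y) (mapp (spinMat l) (f y))) x (e (l + 1))) := by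
  simp only [fderiv_inner_mapp_self hf (conjTranspose_spinMat _),
    fderiv_inner_mapp_self hf (conjTranspose_beta_alpha _), fderiv_radial_mul hx hα hf]
  rw [diracActA, norm_sq_diracActA_eq]
  have h0 : 0 < ‖x‖ := norm_pos_iff.2 hx
  have h1 : ∑ j, (α ‖x‖ * x j * (2 * inner ℝ (f x) (fderiv ℝ f x (e j))) -
      (α ‖x‖ * x j) ^ 2 * ‖f x‖ ^ 2) ≤
        ∑ j, ‖fderiv ℝ f x (e j) - (Complex.I * A x j) • f x‖ ^ 2 :=
    Finset.sum_le_sum fun j _ => two_mul_inner_sub_le _ _ _ _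
  have h2 : ‖x‖ ^ 2 = x 0 ^ 2 + x 1 ^ 2 + x 2 ^ 2 := by
    rw [EuclideanSpace.norm_sq_eq, Fin.sum_univ_three]
    simp
  have h3 : a * ‖x‖⁻¹ * x 0 ^ 2 + a * ‖x‖⁻¹ * x 1 ^ 2 + a * ‖x‖⁻¹ * x 2 ^ 2 = ‖x‖ * a := by
    rw [← mul_add, ← mul_add, ← h2]
    field_simp
  have h4 := mul_le_mul_of_nonneg_right hc (sq_nonneg ‖f x‖)
  have h5 : (-(3 * α ‖x‖ + ‖x‖ * a) - ‖x‖ ^ 2 * α ‖x‖ ^ 2) * ‖f x‖ ^ 2 =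
      -∑ j, (a * ‖x‖⁻¹ * x j ^ 2 + α ‖x‖) * ‖f x‖ ^ 2 -
        ∑ j, (α ‖x‖ * x j) ^ 2 * ‖f x‖ ^ 2 := by
    simp only [Fin.sum_univ_three]
    rw [← h3]
    linear_combination (-(α ‖x‖ ^ 2) * ‖f x‖ ^ 2) * h2
  have h6 := sq_nonneg ‖f x‖
  simp only [Finset.sum_add_distrib, Finset.sum_sub_distrib] at *
  linarith

theorem radial_weight_le {A : V3 → V3} (hA : LocallyIntegrable (fun x : V3 => ‖A x‖ ^ 3) volume)
    {HA : DSp →ₗ.[ℂ] DSp} (hHA : IsMagneticDirac A HA) {Bfun : V3 → V3} (hcurl : IsCurlOf A Bfun)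
    {Bb : ℝ} (hBb : ∀ᵐ x : V3 ∂volume, ‖Bfun x‖ ≤ Bb) {α α' : ℝ → ℝ}
    (hα : ∀ r, 0 < r → HasDerivAt α (α' r) r) (hα' : ContinuousOn α' (Set.Ioi 0))
    {w : V3 → ℝ} (hw : IsBddMeas w)
    (hwα : ∀ x, x ≠ 0 → w x ≤ -(3 * α ‖x‖ + ‖x‖ * α' ‖x‖) - ‖x‖ ^ 2 * α ‖x‖ ^ 2)
    {f : V3 → C4} (hf : IsTestFnAway f) {u : DSp} (huf : u =ᵐ[volume] f) (hu : u ∈ HA.domain) :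
    ∫ x, w x * ‖u x‖ ^ 2 ≤ ‖HA ⟨u, hu⟩‖ ^ 2 + Bb * ‖u‖ ^ 2 := by
  have hAl := hHA.locallyIntegrable hA
  obtain ⟨_, hH⟩ := hHA.2.2 u f hf huf
  have hf2 : ContDiff ℝ 2 f := hf.1.of_le (WithTop.coe_le_coe.2 (le_top : (2 : ℕ∞) ≤ ⊤))
  have hf1 : ContDiff ℝ 1 f := hf.1.of_le (by exact_mod_cast le_top)
  have cM := fun M => hasCompactSupport_inner_mapp hf.2.1 f M
  have cψ : ∀ j : Fin 3, HasCompactSupport fun y : V3 => α ‖y‖ * y j * ‖f y‖ ^ 2 := fun j =>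
    hf.2.1.mono fun x hx h => hx (by simp [h])
  have iψ := fun j => integrable_fderiv_apply (contDiff_radial_mul hα hα' hf j) (cψ j) (e j)
  have zψ := fun j => integral_fderiv_apply_eq_zero (contDiff_radial_mul hα hα' hf j) (cψ j) (e j)
  have iM := fun j : Fin 3 => integrable_fderiv_apply
    (contDiff_inner_mapp hf1 hf1 (-Complex.I • (diracβ * diracα j))) (cM _) (e j)
  have zM := fun j : Fin 3 => integral_fderiv_apply_eq_zero
    (contDiff_inner_mapp hf1 hf1 (-Complex.I • (diracβ * diracα j))) (cM _) (e j)
  have N := fun l : Fin 3 => integral_inner_fderiv_skew hf2 hf.2.1 (conjTranspose_alpha_alpha l)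
    (e (l + 1)) (e (l + 2))
  have hφ := fun l => contDiff_inner_mapp hf.1 hf.1 (spinMat l)
  have iA : ∀ l, Integrable (fun x => A x (l + 1) *
        fderiv ℝ (fun y => inner ℝ (f y) (mapp (spinMat l) (f y))) x (e (l + 2)) -
      A x (l + 2) * fderiv ℝ (fun y => inner ℝ (f y) (mapp (spinMat l) (f y))) x (e (l + 1)))
      volume := fun l => (integrable_mul_fderiv (hAl _) (hφ l) (cM _) _).sub
        (integrable_mul_fderiv (hAl _) (hφ l) (cM _) _)
  choose b hbm hb hbφ using hcurl.exists_aemeasurable hAl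
  have hnb : ∀ᵐ x, ‖(WithLp.toLp 2 fun l => b l x : V3)‖ ≤ Bb := by
    filter_upwards [hBb] with x hx
    refine le_trans ?_ hx
    rw [EuclideanSpace.norm_eq, EuclideanSpace.norm_eq]
    refine Real.sqrt_le_sqrt (Finset.sum_le_sum fun l _ => ?_)
    rcases hb l x with h | h <;> simp [h, sq_nonneg]
  have iφ : ∀ l, Integrable (fun x => b l x * inner ℝ (f x) (mapp (spinMat l) (f x))) volume := by
    intro l
    refine ((hφ l).continuous.integrable_of_hasCompactSupport (cM _)).bdd_mul (c := Bb)
      (hbm l).aestronglyMeasurable ?_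
    filter_upwards [hnb] with x hx
    exact (PiLp.norm_apply_le (WithLp.toLp 2 fun l => b l x : V3) l).trans hx
  have hint : Integrable (fun x => ‖f x‖ ^ 2) volume :=
    (integrable_norm_sq u).congr (huf.mono fun x hx => by simp only [hx])
  have ih : Integrable (fun x => ‖diracActA A f x‖ ^ 2) volume :=
    (integrable_norm_sq (HA ⟨u, hu⟩)).congr (hH.mono fun x hx => by simp only [hx])
  have iψs := integrable_finsetSum Finset.univ fun j _ => iψ j
  have iMs := integrable_finsetSum Finset.univ fun j _ => iM j
  have iNs := integrable_finsetSum Finset.univ fun l _ => (N l).1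
  have iAs := integrable_finsetSum Finset.univ fun l _ => iA l
  have hB : ∑ l, ∫ x, b l x * inner ℝ (f x) (mapp (spinMat l) (f x)) ≤ Bb * ∫ x, ‖f x‖ ^ 2 := by
    rw [← integral_finsetSum _ fun l _ => iφ l, ← integral_const_mul]
    refine integral_mono_ae (integrable_finsetSum _ fun l _ => iφ l) (hint.const_mul Bb) ?_
    filter_upwards [hnb] with x hx
    exact (le_abs_self _).trans ((abs_sum_mul_inner_spinMat_le
      (WithLp.toLp 2 fun l => b l x : V3) (f x)).trans
        (mul_le_mul_of_nonneg_right hx (sq_nonneg _)))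
  have hu2 : ‖u‖ ^ 2 = ∫ x, ‖f x‖ ^ 2 := by
    rw [norm_sq_eq_integral]
    exact integral_congr_ae (huf.mono fun x hx => by simp only [hx])
  have hH2 : ‖HA ⟨u, hu⟩‖ ^ 2 = ∫ x, ‖diracActA A f x‖ ^ 2 := by
    rw [norm_sq_eq_integral]
    exact integral_congr_ae (hH.mono fun x hx => by simp only [hx])
  rw [hu2, hH2]
  refine (integral_mono_ae (hw.integrable u) ((((ih.sub iψs).sub iMs).sub iNs).add iAs)
    (?_ : _ ≤ᵐ[volume] _)).trans ?_
  · filter_upwards [huf, compl_mem_ae_iff.2 (measure_singleton (0 : V3))] with x hx hx0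
    rw [hx]
    exact radial_mul_norm_sq_le hx0 (hα _ (norm_pos_iff.2 hx0)) (hf1.differentiable one_ne_zero x)
      (hwα x hx0)
  · rw [integral_add' (((ih.sub iψs).sub iMs).sub iNs) iAs,
      integral_sub' ((ih.sub iψs).sub iMs) iNs,
      integral_sub' (ih.sub iψs) iMs, integral_sub' ih iψs, integral_finsetSum _ fun j _ => iψ j,
      integral_finsetSum _ fun j _ => iM j, integral_finsetSum _ fun l _ => (N l).1,
      integral_finsetSum _ fun l _ => iA l]
    simp only [zψ, zM, fun l => (N l).2, fun l => (hbφ l _ (hφ l) (cM _)).symm]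
    simp only [Finset.sum_const_zero, sub_zero]
    linarith

end Core

section Extension

theorem exists_testFnAway_of_mem_testSubAway {u : DSp} (hu : u ∈ testSubAway) :
    ∃ f : V3 → C4, IsTestFnAway f ∧ u =ᵐ[volume] f := by
  refine Submodule.span_induction (fun u hu => hu) ?_ ?_ ?_ hu
  · exact ⟨fun _ => 0, ⟨contDiff_const, HasCompactSupport.zero, by simp [tsupport]⟩,
      Lp.coeFn_zero _ _ _⟩
  · rintro u v - - ⟨f, ⟨hf1, hf2, hf3⟩, hf⟩ ⟨g, ⟨hg1, hg2, hg3⟩, hg⟩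
    refine ⟨f + g, ⟨hf1.add hg1, hf2.add hg2, fun h => ?_⟩, ?_⟩
    · rcases tsupport_add f g h with h | h
      exacts [hf3 h, hg3 h]
    · filter_upwards [Lp.coeFn_add u v, hf, hg] with x h1 h2 h3
      rw [h1, Pi.add_apply, Pi.add_apply, h2, h3]
  · rintro c u - ⟨f, ⟨hf1, hf2, hf3⟩, hf⟩
    have hs : tsupport (c • f) ⊆ tsupport f := closure_mono fun x hx h => hx (by simp [h])
    refine ⟨c • f, ⟨hf1.const_smul c, hf2.mono' (subset_closure.trans hs), fun h => hf3 (hs h)⟩, ?_⟩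
    filter_upwards [Lp.coeFn_smul c u, hf] with x h1 h2
    rw [h1, Pi.smul_apply, Pi.smul_apply, h2]

/-- A closed condition on the graph of an operator may be checked on a core. -/
theorem IsCore.of_isClosed {X : Type*} [NormedAddCommGroup X] [NormedSpace ℂ X]
    {T : X →ₗ.[ℂ] X} {D : Submodule ℂ X} (hD : IsCore T D) {C : Set (X × X)}
    (hC : IsClosed C) (h : ∀ (u : X) (hu : u ∈ T.domain), u ∈ D → (u, T ⟨u, hu⟩) ∈ C)
    {u : X} (hu : u ∈ T.domain) : (u, T ⟨u, hu⟩) ∈ C := by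
  by_cases hc : (T.domRestrict D).IsClosable
  · have h1 : ((T.domRestrict D).graph : Set (X × X)) ⊆ C := by
      rintro ⟨a, b⟩ hab
      obtain ⟨⟨y, hy⟩, rfl, rfl⟩ := (LinearPMap.mem_graph_iff _).1 hab
      exact (LinearPMap.domRestrict_apply (x := ⟨y, hy⟩) (y := ⟨y, hy.2⟩) rfl :
        T.domRestrict D ⟨y, hy⟩ = _) ▸ h y hy.2 hy.1
    have h2 : (u, T ⟨u, hu⟩) ∈ (T.domRestrict D).graph.topologicalClosure := by
      rw [hc.graph_closure_eq_closure_graph, hD.2]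
      exact LinearPMap.mem_graph T ⟨u, hu⟩
    exact closure_minimal h1 hC h2
  · have h3 : T.domRestrict D = T := by rw [← LinearPMap.closure_def' hc, hD.2]
    refine h u hu ?_
    rw [← h3] at hu
    exact hu.1

theorem radial_weight_le_of_mem_domain {A : V3 → V3}
    (hA : LocallyIntegrable (fun x : V3 => ‖A x‖ ^ 3) volume)
    {HA : DSp →ₗ.[ℂ] DSp} (hHA : IsMagneticDirac A HA) {Bfun : V3 → V3} (hcurl : IsCurlOf A Bfun)
    {Bb : ℝ} (hBb : ∀ᵐ x : V3 ∂volume, ‖Bfun x‖ ≤ Bb) {α α' : ℝ → ℝ}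
    (hα : ∀ r, 0 < r → HasDerivAt α (α' r) r) (hα' : ContinuousOn α' (Set.Ioi 0))
    {w : V3 → ℝ} (hw : IsBddMeas w)
    (hwα : ∀ x, x ≠ 0 → w x ≤ -(3 * α ‖x‖ + ‖x‖ * α' ‖x‖) - ‖x‖ ^ 2 * α ‖x‖ ^ 2)
    {u : DSp} (hu : u ∈ HA.domain) :
    ∫ x, w x * ‖u x‖ ^ 2 ≤ ‖HA ⟨u, hu⟩‖ ^ 2 + Bb * ‖u‖ ^ 2 := by
  rw [← re_inner_mulOp hw]
  refine hHA.2.1.of_isClosed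
    (C := {p : DSp × DSp | (inner ℂ p.1 (mulOp w p.1)).re ≤ ‖p.2‖ ^ 2 + Bb * ‖p.1‖ ^ 2})
    (isClosed_le (by fun_prop) (by fun_prop)) (fun v hv hvD => ?_) hu
  obtain ⟨f, hf, hvf⟩ := exists_testFnAway_of_mem_testSubAway hvD
  have h := radial_weight_le hA hHA hcurl hBb hα hα' hw hwα hf hvf hv
  rwa [← re_inner_mulOp hw] at h

theorem integral_weight_le_of_tendsto {u : DSp} {g : V3 → ℝ} {w : ℕ → V3 → ℝ} {C : ℝ}
    (hw : ∀ n, IsBddMeas (w n)) (hw0 : ∀ n x, 0 ≤ w n x) (hC : ∀ n, ∫ x, w n x * ‖u x‖ ^ 2 ≤ C)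
    (hlim : ∀ x, x ≠ 0 → Tendsto (fun n => w n x) atTop (𝓝 (g x))) :
    Integrable (fun x => g x * ‖u x‖ ^ 2) volume ∧ ∫ x, g x * ‖u x‖ ^ 2 ≤ C := by
  have hI := fun n => (hw n).integrable u
  have hlim' : ∀ᵐ x : V3, Tendsto (fun n => w n x * ‖u x‖ ^ 2) atTop (𝓝 (g x * ‖u x‖ ^ 2)) := by
    filter_upwards [compl_mem_ae_iff.2 (measure_singleton (0 : V3))] with x hx
    exact (hlim x hx).mul_const _
  have hm : AEStronglyMeasurable (fun x => g x * ‖u x‖ ^ 2) volume :=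
    aestronglyMeasurable_of_tendsto_ae atTop (fun n => (hI n).1) hlim'
  have h0 : 0 ≤ᵐ[volume] fun x => g x * ‖u x‖ ^ 2 := by
    filter_upwards [hlim'] with x hx
    exact ge_of_tendsto' hx fun n => mul_nonneg (hw0 n x) (sq_nonneg _)
  have hC0 : 0 ≤ C :=
    (integral_nonneg fun x => mul_nonneg (hw0 0 x) (sq_nonneg _)).trans (hC 0)
  have hF : ∫⁻ x, ENNReal.ofReal (g x * ‖u x‖ ^ 2) ≤ ENNReal.ofReal C := by
    calc ∫⁻ x, ENNReal.ofReal (g x * ‖u x‖ ^ 2)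
        = ∫⁻ x, liminf (fun n => ENNReal.ofReal (w n x * ‖u x‖ ^ 2)) atTop := by
          refine lintegral_congr_ae ?_
          filter_upwards [hlim'] with x hx
          exact (ENNReal.tendsto_ofReal hx).liminf_eq.symm
      _ ≤ liminf (fun n => ∫⁻ x, ENNReal.ofReal (w n x * ‖u x‖ ^ 2)) atTop :=
          lintegral_liminf_le' fun n => (hI n).1.aemeasurable.ennreal_ofReal
      _ ≤ ENNReal.ofReal C := by
          refine liminf_le_of_le (by isBoundedDefault) fun b hb => ?_
          obtain ⟨n, hn⟩ := hb.exists
          refine hn.trans ?_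
          rw [← ofReal_integral_eq_lintegral_ofReal (hI n)
            (Eventually.of_forall fun x => mul_nonneg (hw0 n x) (sq_nonneg _))]
          exact ENNReal.ofReal_le_ofReal (hC n)
  refine ⟨⟨hm, ?_⟩, ?_⟩
  · rw [hasFiniteIntegral_iff_ofReal h0]
    exact hF.trans_lt ENNReal.ofReal_lt_top
  · rw [integral_eq_lintegral_of_nonneg_ae h0 hm]
    exact ENNReal.toReal_le_of_le_ofReal hC0 hF

theorem integral_norm_sq_div_sq_le {A : V3 → V3}
    (hA : LocallyIntegrable (fun x : V3 => ‖A x‖ ^ 3) volume)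
    {HA : DSp →ₗ.[ℂ] DSp} (hHA : IsMagneticDirac A HA) {Bfun : V3 → V3} (hcurl : IsCurlOf A Bfun)
    {Bb : ℝ} (hBb : ∀ᵐ x : V3 ∂volume, ‖Bfun x‖ ≤ Bb) {u : DSp} (hu : u ∈ HA.domain) :
    Integrable (fun x : V3 => ‖u x‖ ^ 2 / ‖x‖ ^ 2) volume ∧
      ∫ x : V3, ‖u x‖ ^ 2 / ‖x‖ ^ 2 ≤ 4 * ‖HA ⟨u, hu⟩‖ ^ 2 + 4 * Bb * ‖u‖ ^ 2 := by
  have hw0 : ∀ (n : ℕ) (x : V3), 0 ≤ min (1 / (4 * ‖x‖ ^ 2)) (n : ℝ) := fun n x =>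
    le_min (by positivity) n.cast_nonneg
  have hw : ∀ n : ℕ, IsBddMeas fun x : V3 => min (1 / (4 * ‖x‖ ^ 2)) (n : ℝ) := fun n =>
    ⟨by fun_prop, n, fun x => by rw [abs_of_nonneg (hw0 n x)]; exact min_le_right _ _⟩
  have hα : ∀ r : ℝ, 0 < r → HasDerivAt (fun r : ℝ => -(1 / 2) * (r ^ 2)⁻¹) ((r ^ 3)⁻¹) r := by
    intro r hr
    refine (((hasDerivAt_pow 2 r).inv (by positivity)).const_mul (-(1 / 2) : ℝ)).congr_deriv ?_
    field_simp
    norm_num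
  obtain ⟨h1, h2⟩ := integral_weight_le_of_tendsto (u := u)
    (g := fun x => 1 / (4 * ‖x‖ ^ 2)) (C := ‖HA ⟨u, hu⟩‖ ^ 2 + Bb * ‖u‖ ^ 2) hw hw0 (fun n => by
      refine radial_weight_le_of_mem_domain hA hHA hcurl hBb hα
        ((by fun_prop : Continuous fun r : ℝ => r ^ 3).continuousOn.inv₀
          fun r hr => pow_ne_zero 3 (ne_of_gt hr)) (hw n) (fun x hx => ?_) hu
      refine (min_le_left _ _).trans_eq ?_
      have : ‖x‖ ≠ 0 := norm_ne_zero_iff.2 hx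
      field_simp
      norm_num) (fun x _ => by
      refine tendsto_const_nhds.congr' ?_
      filter_upwards [eventually_ge_atTop ⌈1 / (4 * ‖x‖ ^ 2)⌉₊] with n hn
      exact (min_eq_left (Nat.ceil_le.1 hn)).symm)
  have h3 : (fun x : V3 => ‖u x‖ ^ 2 / ‖x‖ ^ 2) =
      fun x => 4 * (1 / (4 * ‖x‖ ^ 2) * ‖u x‖ ^ 2) := by
    funext x
    ring
  rw [h3, integral_const_mul]
  exact ⟨h1.const_mul 4, by linarith⟩

end Extension

section Inverse

variable {H : Type*} [NormedAddCommGroup H] [InnerProductSpace ℂ H] [CompleteSpace H]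

theorem IsResolventAt.exists_apply_eq {X : Type*} [NormedAddCommGroup X] [NormedSpace ℂ X]
    {T : X →ₗ.[ℂ] X} {R : X →L[ℂ] X} (hR : IsResolventAt T 0 R) (y : X) :
    ∃ hy : R y ∈ T.domain, T ⟨R y, hy⟩ = y := by
  obtain ⟨hy, h⟩ := hR.2 y
  exact ⟨hy, by simpa using h⟩

theorem IsResolventAt.injective {X : Type*} [NormedAddCommGroup X] [NormedSpace ℂ X]
    {T : X →ₗ.[ℂ] X} {R : X →L[ℂ] X} (hR : IsResolventAt T 0 R) : Function.Injective R := by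
  refine (injective_iff_map_eq_zero R).2 fun y hy => ?_
  obtain ⟨h, h'⟩ := hR.exists_apply_eq y
  have : (⟨R y, h⟩ : T.domain) = 0 := Subtype.ext hy
  rw [← h', this, T.map_zero]

theorem IsResolventAt.isSelfAdjoint {T : H →ₗ.[ℂ] H} {R : H →L[ℂ] H} (hT : T.adjoint = T)
    (hR : IsResolventAt T 0 R) : IsSelfAdjoint R := by
  have hd : Dense (T.domain : Set H) := IsSelfAdjoint.dense_domain (A := T) hT
  have hs : ∀ x y : T.domain, inner ℂ (T x) (y : H) = inner ℂ (x : H) (T y) := by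
    have h := LinearPMap.adjoint_isFormalAdjoint hd
    rwa [hT] at h
  refine ContinuousLinearMap.isSelfAdjoint_iff_isSymmetric.2 fun x y => ?_
  obtain ⟨hx, hx'⟩ := hR.exists_apply_eq x
  obtain ⟨hy, hy'⟩ := hR.exists_apply_eq y
  have h := hs ⟨R x, hx⟩ ⟨R y, hy⟩
  rw [hx', hy'] at h
  exact h.symm

theorem invSqrtAbs_injective {R : H →L[ℂ] H} (hR : IsSelfAdjoint R)
    (hinj : Function.Injective R) : Function.Injective (invSqrtAbs R) := by
  refine (injective_iff_map_eq_zero _).2 fun y hy => hinj ?_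
  have hS : Continuous fun s : ℝ => √|s| := by fun_prop
  have h : ‖R y‖ ^ 2 = ‖cfc (fun s : ℝ => |s|) R y‖ ^ 2 := by
    conv_lhs => rw [← cfc_id' ℝ R]
    rw [norm_sq_cfc_apply (f := fun s => s) continuous_id', norm_sq_cfc_apply continuous_abs]
    simp
  have h0 : cfc (fun s : ℝ => |s|) R y = 0 := by
    have h1 := cfc_mul_apply (R := R) hS hS y
    simp only [Real.mul_self_sqrt (abs_nonneg _)] at h1
    rw [← h1, ← invSqrtAbs_eq_cfc hR, hy, map_zero]
  rw [h0] at h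
  simpa using h

theorem apply_pApply_pinv {E : Type*} [NormedAddCommGroup E] [InnerProductSpace ℂ E]
    {J : E →L[ℂ] E} (hJ : Function.Injective J) {u : E} (hu : u ∈ (pinv J).domain) :
    J (pApply (pinv J) u) = u := by
  rw [pApply, dif_pos hu]
  obtain ⟨⟨a, b⟩, hab, h⟩ := Submodule.mem_graph_toLinearPMap
    (g := (LinearMap.graph (J : E →ₗ[ℂ] E)).map
      ((LinearEquiv.prodComm ℂ E E) : E × E →ₗ[ℂ] E × E)) (by
        rintro _ ⟨⟨a, b⟩, hab, rfl⟩ h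
        have hb : b = J a := hab
        have h0 : b = 0 := h
        exact hJ ((hb.symm.trans h0).trans (map_zero J).symm)) ⟨u, hu⟩
  have hb : b = J a := hab
  have h1 : b = u := congrArg Prod.fst h
  have h2 : a = pinv J ⟨u, hu⟩ := congrArg Prod.snd h
  rw [← h2, ← hb, h1]

end Inverse

theorem integral_norm_sq_div_le {A : V3 → V3}
    (hA : LocallyIntegrable (fun x : V3 => ‖A x‖ ^ 3) volume)
    {HA : DSp →ₗ.[ℂ] DSp} (hHA : IsMagneticDirac A HA) {Bfun : V3 → V3} (hcurl : IsCurlOf A Bfun)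
    {Bb : ℝ} (hBb0 : 0 ≤ Bb) (hBb : ∀ᵐ x : V3 ∂volume, ‖Bfun x‖ ≤ Bb)
    {RA : DSp →L[ℂ] DSp} (hRA : IsResolventAt HA 0 RA) (y : DSp) :
    Integrable (fun x : V3 => ‖invSqrtAbs RA y x‖ ^ 2 / ‖x‖) volume ∧
      ∫ x : V3, ‖invSqrtAbs RA y x‖ ^ 2 / ‖x‖ ≤
        Real.pi / 2 * ‖y‖ ^ 2 + Real.pi / 2 * √Bb * ‖invSqrtAbs RA y‖ ^ 2 := by
  have hsa := hRA.isSelfAdjoint hHA.1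
  set u := invSqrtAbs RA y with hu
  have hδ : ∀ n : ℕ, (0 : ℝ) < 1 / ((n : ℝ) + 1) := fun n => Nat.one_div_pos_of_nat
  have hV : ∀ t : ℝ, 0 < t →
      ∫ x : V3, katoV t ‖x‖ * ‖u x‖ ^ 2 ≤ ‖y‖ ^ 2 + √Bb * ‖u‖ ^ 2 := by
    intro t ht
    rw [← re_inner_mulOp (isBddMeas_katoV ht)]
    refine riccati_le_inv_abs hsa (Real.sqrt_nonneg Bb)
      (V := fun s => mulOp fun x => katoV s ‖x‖) (G := fun s => mulOp fun x => katoG s ‖x‖)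
      (fun s hs => hasDerivAt_mulOp_katoV hs) (fun s hs => isSelfAdjoint_mulOp (isBddMeas_katoV hs))
      (fun s hs => norm_mulOp_le (isBddMeas_katoV hs) fun x => ?_)
      (fun s hs v => ?_) (fun s hs v => ?_) (fun s hs z => ?_) ht y
    · rw [abs_of_nonneg (katoV_nonneg hs (norm_nonneg _))]
      exact katoV_le hs (norm_nonneg _)
    · rw [re_inner_mulOp (isBddMeas_katoG hs)]
      exact integral_nonneg fun x => mul_nonneg (katoG_nonneg hs (norm_nonneg _)) (sq_nonneg _)
    · rw [re_inner_mulOp (isBddMeas_katoG hs), norm_sq_eq_integral, ← integral_const_mul]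
      exact integral_mono ((isBddMeas_katoG hs).integrable v)
        ((integrable_norm_sq v).const_mul _)
        fun x => mul_le_mul_of_nonneg_right (katoG_le hs (norm_nonneg _)) (sq_nonneg _)
    · obtain ⟨hz, hz'⟩ := hRA.exists_apply_eq z
      rw [re_inner_mulOp (isBddMeas_katoG hs), Real.sq_sqrt hBb0]
      have h := radial_weight_le_of_mem_domain hA hHA hcurl hBb
        (fun r hr => hasDerivAt_katoF hs hr) (continuousOn_katoF' hs) (isBddMeas_katoG hs)
        (fun x hx => (katoF_identity hs (norm_pos_iff.2 hx)).ge) hz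
      rwa [hz'] at h
  have hlim : Tendsto (fun n : ℕ => 1 / ((n : ℝ) + 1)) atTop (𝓝[>] 0) :=
    tendsto_nhdsWithin_iff.2
      ⟨tendsto_one_div_add_atTop_nhds_zero_nat, Eventually.of_forall fun n => hδ n⟩
  obtain ⟨h1, h2⟩ := integral_weight_le_of_tendsto (u := u) (g := fun x => 2 / Real.pi / ‖x‖)
    (w := fun n x => katoV (1 / ((n : ℝ) + 1)) ‖x‖)
    (fun n => isBddMeas_katoV (hδ n)) (fun n x => katoV_nonneg (hδ n) (norm_nonneg _))
    (fun n => hV _ (hδ n)) (fun x hx => (tendsto_katoV (norm_pos_iff.2 hx)).comp hlim)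
  have h3 : (fun x : V3 => ‖u x‖ ^ 2 / ‖x‖) =
      fun x => Real.pi / 2 * (2 / Real.pi / ‖x‖ * ‖u x‖ ^ 2) := by
    funext x
    have := Real.pi_pos.ne'
    field_simp
  rw [h3, integral_const_mul]
  refine ⟨h1.const_mul _, ?_⟩
  calc _ ≤ Real.pi / 2 * (‖y‖ ^ 2 + √Bb * ‖u‖ ^ 2) :=
        mul_le_mul_of_nonneg_left h2 (by positivity)
    _ = _ := by ring

/-!
STATEMENT 15 (Hardy and Kato inequalities for the magnetic Dirac operator):
Let `A ∈ L³_loc(ℝ³, ℝ³)` and let `H_A` be (the self-adjoint closure of) the magnetic Dirac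
operator, essentially self-adjoint on `C₀^∞(ℝ³ \ {0})⁴`.  Assume `B = curl A`
(distributionally, represented by `Bfun`) is essentially bounded with `‖B‖_∞ ≤ Bb` a.e.
(for the essential supremum `Bb = ‖B‖_∞` this is the optimal choice).  Then:
(i) `‖|x|⁻¹u‖² ≤ 4‖H_A u‖² + 4‖B‖_∞‖u‖²` for `u ∈ dom H_A`;
(ii) `|(|x|⁻¹u, u)| ≤ (π/2)‖|H_A|^{1/2}u‖² + (π/2)√(‖B‖_∞)‖u‖²` for
`u ∈ dom |H_A|^{1/2}` (with `|H_A|^{1/2} = sqrtAbsPMap RA`, `RA = H_A⁻¹`, which exists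
since `(-1, 1)` is a spectral gap of `H_A`).
-/

theorem statement_15
    (A : V3 → V3) (hA : MeasureTheory.LocallyIntegrable (fun x : V3 => ‖A x‖ ^ 3) volume)
    (HA : DSp →ₗ.[ℂ] DSp) (hHA : IsMagneticDirac A HA)
    (Bfun : V3 → V3) (hcurl : IsCurlOf A Bfun)
    (Bb : ℝ) (hBb0 : 0 ≤ Bb) (hBb : ∀ᵐ x : V3 ∂volume, ‖Bfun x‖ ≤ Bb)
    (RA : DSp →L[ℂ] DSp) (hRA : IsResolventAt HA 0 RA) :
    -- (i)
    (∀ u : DSp, ∀ hu : u ∈ HA.domain,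
      MeasureTheory.Integrable (fun x : V3 => ‖(u : V3 → C4) x‖ ^ 2 / ‖x‖ ^ 2) volume ∧
      ∫ x : V3, ‖(u : V3 → C4) x‖ ^ 2 / ‖x‖ ^ 2 ≤
        4 * ‖HA ⟨u, hu⟩‖ ^ 2 + 4 * Bb * ‖u‖ ^ 2) ∧
    -- (ii)
    (∀ u : DSp, u ∈ (sqrtAbsPMap RA).domain →
      MeasureTheory.Integrable (fun x : V3 => ‖(u : V3 → C4) x‖ ^ 2 / ‖x‖) volume ∧
      |∫ x : V3, ‖(u : V3 → C4) x‖ ^ 2 / ‖x‖| ≤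
        (Real.pi / 2) * ‖pApply (sqrtAbsPMap RA) u‖ ^ 2 +
          (Real.pi / 2) * Real.sqrt Bb * ‖u‖ ^ 2) := by
  refine ⟨fun u hu => integral_norm_sq_div_sq_le hA hHA hcurl hBb hu, fun u hu => ?_⟩
  have hu' := apply_pApply_pinv
    (invSqrtAbs_injective (hRA.isSelfAdjoint hHA.1) hRA.injective) hu
  obtain ⟨h1, h2⟩ :=
    integral_norm_sq_div_le hA hHA hcurl hBb0 hBb hRA (pApply (sqrtAbsPMap RA) u)
  rw [sqrtAbsPMap, hu'] at h1 h2
  rw [abs_of_nonneg (integral_nonneg fun x => by positivity)]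
  exact ⟨h1, h2⟩

end Paper
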